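/- arXiv:math/0508517 — 2 statements merged into one kernel-verified Lean document; each statement's English description precedes it below -/
import Mathlib

section
/- Let A ∈ M_{s+1,n−s}(ℝ) with s ≥ 1 and let A' ∈ M_{s,n−s}(ℝ) be obtained from A by removing one of its rows. Then ω_j(A') ≥ ω_j(A) for all j. If moreover the removed row is a rational linear combination of the remaining rows, then ω_j(A') = ω_j(A) for all j. -/
open Finset Real ENNReal

/-- The index `0` in `Fin (m + 1 + c)`. -/
def zeroIdx (m c : ℕ) : Fin (m + 1 + c) := ⟨0, by omega⟩

/-- The coefficient `⟨e_i ∧ e_J, w⟩` of `w ∈ Λ(ℝ^N)` in coordinates with respect to the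
orthonormal basis `{e_I}`. -/
def wedgeCoeff {N : ℕ} (i : Fin N) (J : Finset (Fin N)) (w : Finset (Fin N) → ℝ) : ℝ :=
  if i ∈ J then 0 else (-1 : ℝ) ^ (J.filter (· < i)).card * w (insert i J)

/-- The `i`-th row of `A ∈ M_{m+1,c}(ℝ)` viewed as the vector
`a_i = Σ_{k} A i k · e_{m+1+k}` in `V_• = span(e_{m+1},…,e_{m+c}) ⊆ ℝ^{m+1+c}`. -/
def rowVec {m c : ℕ} (A : Matrix (Fin (m + 1)) (Fin c) ℝ) (i : Fin (m + 1)) :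
    Fin (m + 1 + c) → ℝ :=
  fun t => if h : m + 1 ≤ (t : ℕ) then A i ⟨(t : ℕ) - (m + 1), by omega⟩ else 0

/-- `⟨(e_i + a_i) ∧ e_J, w⟩`, the `(i, J)`-entry of `R_A c(w)` where `R_A = (I_{m+1} | A)`. -/
def rowCoeff {m c : ℕ} (A : Matrix (Fin (m + 1)) (Fin c) ℝ) (i : Fin (m + 1))
    (J : Finset (Fin (m + 1 + c))) (w : Finset (Fin (m + 1 + c)) → ℝ) : ℝ :=
  wedgeCoeff (Fin.castLE (by omega) i) J w + ∑ t, rowVec A i t * wedgeCoeff t J w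

/-- The orthogonal projection `π_•` of `Λ(ℝ^N)` onto `Λ(V_•)`,
`V_• = span(e_{m+1}, e_{m+2}, …)`, in coordinates. -/
def piBullet {N : ℕ} (m : ℕ) (w : Finset (Fin N) → ℝ) : Finset (Fin N) → ℝ :=
  fun I => if ∀ t ∈ I, m + 1 ≤ (t : ℕ) then w I else 0

/-- The Euclidean norm on `Λ(ℝ^N)` in coordinates. -/
noncomputable def normL {N : ℕ} (w : Finset (Fin N) → ℝ) : ℝ :=
  Real.sqrt (∑ I : Finset (Fin N), w I ^ 2)

/-- `w ∈ Λʲ(ℝ^N)` represents a rank-`j` subgroup of `ℤ^N`: it is the wedge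
`v₁ ∧ ⋯ ∧ v_j` of a `ℤ`-basis `v₁, …, v_j` (a linearly independent family of integer
vectors) of such a subgroup, in coordinates. -/
def Represents {N : ℕ} (j : ℕ) (w : Finset (Fin N) → ℝ) : Prop :=
  ∃ v : Fin j → (Fin N → ℤ), LinearIndependent ℤ v ∧ ∀ I : Finset (Fin N),
    w I = if h : I.card = j then
      Matrix.det (Matrix.of fun a b : Fin j => ((v a (I.orderIsoOfFin h b) : ℤ) : ℝ))
    else 0

/-- The higher order Diophantine exponent `ω_j(A)` of `A ∈ M_{m+1,c}(ℝ)` (so that the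
ambient space is `ℝ^{m+1+c}`): the supremum of `v` for which there exist `w ∈ Λʲ`
representing rank-`j` subgroups of `ℤ^{m+1+c}` with `‖π_•(w)‖` arbitrarily large such that
`max_{i, J ⊆ {1,…}, #J = j−1} |⟨(e_i + a_i) ∧ e_J, w⟩| < ‖π_•(w)‖^{−(v+1−j)/j}`. -/
noncomputable def omegaHigher (m c : ℕ) (A : Matrix (Fin (m + 1)) (Fin c) ℝ) (j : ℕ) :
    ℝ≥0∞ :=
  sSup {e : ℝ≥0∞ | ∃ v : ℝ, e = ENNReal.ofReal v ∧ ∀ M : ℝ, 0 < M →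
    ∃ w : Finset (Fin (m + 1 + c)) → ℝ, Represents j w ∧ M < normL (piBullet m w) ∧
      ∀ (i : Fin (m + 1)) (J : Finset (Fin (m + 1 + c))), zeroIdx m c ∉ J →
        J.card = j - 1 →
        |rowCoeff A i J w| < (normL (piBullet m w)) ^ (-((v + 1 - (j : ℝ)) / j))}


noncomputable section

/-- Plücker coordinates of a tuple of integer vectors. -/
def plu {N j : ℕ} (v : Fin j → (Fin N → ℤ)) : Finset (Fin N) → ℝ := fun I =>
  if h : I.card = j then
      Matrix.det (Matrix.of fun a b : Fin j => ((v a (I.orderIsoOfFin h b) : ℤ) : ℝ))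
    else 0

/-- The alternating form given by pairing with `v₁ ∧ ⋯ ∧ v_j`. -/
def Phi {N j : ℕ} (v : Fin j → (Fin N → ℤ)) : (Fin N → ℝ) [⋀^Fin j]→ₗ[ℝ] ℝ :=
  (Matrix.detRowAlternating (n := Fin j) (R := ℝ)).compLinearMap
    (Matrix.mulVecLin (Matrix.of fun a t => ((v a t : ℤ) : ℝ)))

/-- basis vector -/
def bv {N : ℕ} (t : Fin N) : Fin N → ℝ := Pi.single t 1

lemma Phi_apply {N j : ℕ} (v : Fin j → (Fin N → ℤ)) (f : Fin j → Fin N → ℝ) :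
    Phi v f = Matrix.det (Matrix.of fun a b : Fin j => ∑ t, (v a t : ℝ) * f b t) := by
  rw [← Matrix.det_transpose]
  rfl

lemma Phi_bv {N j : ℕ} (v : Fin j → (Fin N → ℤ)) (g : Fin j → Fin N) :
    Phi v (fun b => bv (g b)) = Matrix.det (Matrix.of fun a b : Fin j => (v a (g b) : ℝ)) := by
  rw [Phi_apply]
  congr 1
  ext a b
  simp [bv, Pi.single_apply]

lemma plu_eq {N j : ℕ} (v : Fin j → (Fin N → ℤ)) (I : Finset (Fin N)) (h : I.card = j) :
    plu v I = Phi v (fun b => bv (I.orderEmbOfFin h b)) := by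
  rw [Phi_bv, plu, dif_pos h]
  rfl

lemma insertNth_ord {N k : ℕ} (J : Finset (Fin N)) (h : J.card = k) (t : Fin N) (ht : t ∉ J)
    (h' : (insert t J).card = k + 1) :
    ∃ p : Fin (k + 1), (p : ℕ) = (J.filter (· < t)).card ∧
      p.insertNth t (J.orderEmbOfFin h) = (insert t J).orderEmbOfFin h' := by
  have hle : (J.filter (· < t)).card < k + 1 := by
    have := Finset.card_filter_le J (· < t)
    omega
  have key : ∀ b : Fin k, J.orderEmbOfFin h b < t ↔ (b : ℕ) < (J.filter (· < t)).card := by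
    intro b
    have hcard : ∀ s : Fin N → Prop, ∀ [DecidablePred s], (J.filter s).card =
        (Finset.univ.filter (fun b : Fin k => s (J.orderEmbOfFin h b))).card := by
      intro s _
      have : J = Finset.univ.map (J.orderEmbOfFin h).toEmbedding := by
        ext x
        have := Set.ext_iff.1 (Finset.range_orderEmbOfFin J h) x
        simp only [Set.mem_range, Finset.mem_coe] at this
        simp [← this]
      conv_lhs => rw [this]
      rw [Finset.filter_map, Finset.card_map]
      rfl
    rw [hcard]
    constructor
    · intro hb
      have : (Finset.Iic b) ⊆ Finset.univ.filter (fun b : Fin k => J.orderEmbOfFin h b < t) := by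
        intro x hx
        simp only [Finset.mem_Iic] at hx
        simp only [Finset.mem_filter, Finset.mem_univ, true_and]
        exact lt_of_le_of_lt ((J.orderEmbOfFin h).monotone hx) hb
      have := Finset.card_le_card this
      simp at this
      omega
    · intro hb
      by_contra hcon
      have : Finset.univ.filter (fun b : Fin k => J.orderEmbOfFin h b < t) ⊆ Finset.Iio b := by
        intro x hx
        simp only [Finset.mem_filter, Finset.mem_univ, true_and] at hx
        simp only [Finset.mem_Iio]
        by_contra hx'
        exact hcon (lt_of_le_of_lt ((J.orderEmbOfFin h).monotone (not_lt.1 hx')) hx)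
      have := Finset.card_le_card this
      simp at this
      omega
  refine ⟨⟨_, hle⟩, rfl, Finset.orderEmbOfFin_unique h' ?_ ?_⟩
  · intro x
    refine Fin.succAboveCases ⟨_, hle⟩ ?_ ?_ x
    · simp
    · intro b
      rw [Fin.insertNth_apply_succAbove]
      simp
  · intro x y
    have hne : ∀ b, J.orderEmbOfFin h b ≠ t := fun b hb => ht (hb ▸ Finset.orderEmbOfFin_mem J h b)
    refine Fin.succAboveCases ⟨_, hle⟩ ?_ ?_ x <;> refine Fin.succAboveCases ⟨_, hle⟩ ?_ ?_ y
    · simp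
    · intro b hb
      rw [Fin.insertNth_apply_succAbove, Fin.insertNth_apply_same]
      rcases lt_or_ge b.castSucc ⟨_, hle⟩ with h1 | h1
      · rw [Fin.succAbove_of_castSucc_lt _ _ h1] at hb
        exact absurd hb (not_lt.2 h1.le)
      · have : ¬ (J.orderEmbOfFin h b < t) := by
          rw [key]; simpa [Fin.le_def] using h1
        exact lt_of_le_of_ne (not_lt.1 this) (hne b).symm
    · intro b hb
      rw [Fin.insertNth_apply_succAbove, Fin.insertNth_apply_same]
      rcases lt_or_ge b.castSucc ⟨_, hle⟩ with h1 | h1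
      · exact (key b).2 (Fin.lt_def.1 h1)
      · rw [Fin.succAbove_of_le_castSucc _ _ h1] at hb
        rw [Fin.lt_def] at hb
        rw [Fin.le_def] at h1
        simp at hb h1
        omega
    · intro b b' hb
      rw [Fin.insertNth_apply_succAbove, Fin.insertNth_apply_succAbove]
      rw [Fin.succAbove_lt_succAbove_iff] at hb
      exact (J.orderEmbOfFin h).strictMono hb

lemma wedge_eq {N k : ℕ} (v : Fin (k + 1) → (Fin N → ℤ)) (J : Finset (Fin N)) (h : J.card = k)
    (t : Fin N) : wedgeCoeff t J (plu v) =
      Phi v (Matrix.vecCons (bv t) (fun b => bv (J.orderEmbOfFin h b))) := by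
  unfold wedgeCoeff
  split_ifs with ht
  · have : t ∈ Set.range (J.orderEmbOfFin h) := by
      rw [Finset.range_orderEmbOfFin]; exact ht
    obtain ⟨b, hb⟩ := this
    symm
    apply AlternatingMap.map_eq_zero_of_eq _ _ (i := 0) (j := b.succ)
    · simp [hb]
    · exact (Fin.succ_ne_zero b).symm
  · have h' : (insert t J).card = k + 1 := by rw [Finset.card_insert_of_notMem ht, h]
    obtain ⟨p, hp, hp'⟩ := insertNth_ord J h t ht h'
    rw [plu_eq v _ h', ← hp, ← hp']
    have : (fun b => bv (p.insertNth (α := fun _ => Fin N) t (J.orderEmbOfFin h) b)) =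
        p.insertNth (α := fun _ => Fin N → ℝ) (bv t) (fun b => bv (J.orderEmbOfFin h b)) := by
      funext x
      refine Fin.succAboveCases p ?_ ?_ x
      · simp
      · intro b; simp
    rw [this, ← AlternatingMap.neg_one_pow_smul_map_insertNth _ p]
    simp

/-- the vector `e_i + a_i` -/
def rv {m c : ℕ} (A : Matrix (Fin (m + 1)) (Fin c) ℝ) (i : Fin (m + 1)) : Fin (m + 1 + c) → ℝ :=
  bv (Fin.castLE (by omega) i) + rowVec A i

lemma sum_bv {N : ℕ} (x : Fin N → ℝ) : x = ∑ t, x t • bv t := by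
  funext s
  simp [bv, Finset.sum_apply, Pi.single_apply]

lemma map_cons_sum {N k : ℕ} {ι : Type*} [Fintype ι] (Φ : (Fin N → ℝ) [⋀^Fin (k + 1)]→ₗ[ℝ] ℝ)
    (q : ι → ℝ) (x : ι → Fin N → ℝ) (f : Fin k → Fin N → ℝ) :
    Φ (Matrix.vecCons (∑ i, q i • x i) f) = ∑ i, q i * Φ (Matrix.vecCons (x i) f) := by
  let L : (Fin N → ℝ) →ₗ[ℝ] ℝ :=
    { toFun := fun y => Φ (Matrix.vecCons y f)
      map_add' := fun y z => Φ.map_vecCons_add f y z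
      map_smul' := fun c y => Φ.map_vecCons_smul f c y }
  have : L (∑ i, q i • x i) = ∑ i, q i * L (x i) := by simp
  exact this

lemma row_eq {m c k : ℕ} (A : Matrix (Fin (m + 1)) (Fin c) ℝ) (i : Fin (m + 1))
    (v : Fin (k + 1) → (Fin (m + 1 + c) → ℤ)) (J : Finset (Fin (m + 1 + c))) (h : J.card = k) :
    rowCoeff A i J (plu v) =
      Phi v (Matrix.vecCons (rv A i) (fun b => bv (J.orderEmbOfFin h b))) := by
  unfold rowCoeff rv
  rw [AlternatingMap.map_vecCons_add, wedge_eq v J h]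
  congr 1
  conv_rhs => rw [sum_bv (rowVec A i), map_cons_sum]
  exact Finset.sum_congr rfl fun t _ => by rw [wedge_eq v J h]

lemma expand_bound {N k : ℕ} (Ψ : (Fin N → ℝ) [⋀^Fin k]→ₗ[ℝ] ℝ) (B : Fin N → Fin N → ℝ)
    (co : Fin k → Fin N → ℝ) (f : Fin k → Fin N → ℝ) (hf : ∀ b, f b = ∑ τ, co b τ • B τ) :
    |Ψ f| ≤ ∑ g : Fin k → Fin N, (∏ b, |co b (g b)|) * |Ψ (fun b => B (g b))| := by
  have h1 : f = fun b => ∑ τ, co b τ • B τ := funext hf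
  have h2 : Ψ f = ∑ g : Fin k → Fin N, (∏ b, co b (g b)) * Ψ (fun b => B (g b)) := by
    rw [h1]
    have := MultilinearMap.map_sum Ψ.toMultilinearMap (fun b τ => co b τ • B τ)
    simp only [AlternatingMap.coe_multilinearMap] at this
    rw [this]
    refine Finset.sum_congr rfl fun g _ => ?_
    have := Ψ.map_smul_univ (fun b => co b (g b)) (fun b => B (g b))
    rw [this, smul_eq_mul]
  rw [h2]
  refine (Finset.abs_sum_le_sum_abs _ _).trans (le_of_eq ?_)
  refine Finset.sum_congr rfl fun g _ => ?_
  rw [abs_mul, Finset.abs_prod]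

/-- the smallness hypothesis -/
def IsSmallRow {m c k : ℕ} (A : Matrix (Fin (m + 1)) (Fin c) ℝ)
    (Φ : (Fin (m + 1 + c) → ℝ) [⋀^Fin (k + 1)]→ₗ[ℝ] ℝ) (ε : ℝ) : Prop :=
  ∀ (i : Fin (m + 1)) (J : Finset (Fin (m + 1 + c))) (h : J.card = k), zeroIdx m c ∉ J →
    |Φ (Matrix.vecCons (rv A i) (fun b => bv (J.orderEmbOfFin h b)))| ≤ ε

lemma stepA {m c k : ℕ} (A : Matrix (Fin (m + 1)) (Fin c) ℝ)
    (Φ : (Fin (m + 1 + c) → ℝ) [⋀^Fin (k + 1)]→ₗ[ℝ] ℝ) (ε : ℝ) (hε : 0 ≤ ε) (hS : IsSmallRow A Φ ε)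
    (i : Fin (m + 1)) (g : Fin k → Fin (m + 1 + c)) (hg : ∀ b, g b ≠ zeroIdx m c) :
    |Φ (Matrix.vecCons (rv A i) (fun b => bv (g b)))| ≤ ε := by
  rw [← AlternatingMap.curryLeft_apply_apply]
  by_cases hinj : Function.Injective g
  · have hJ : (Finset.univ.image g).card = k := by
      rw [Finset.card_image_of_injective _ hinj]; simp
    set J := Finset.univ.image g with hJdef
    have hmem : ∀ b, g b ∈ J := fun b => Finset.mem_image_of_mem _ (Finset.mem_univ _)
    let e : Fin k → Fin k := fun b => (J.orderIsoOfFin hJ).symm ⟨g b, hmem b⟩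
    have he : ∀ b, J.orderEmbOfFin hJ (e b) = g b := by
      intro b
      rw [← Finset.coe_orderIsoOfFin_apply]
      simp [e]
    have heinj : Function.Injective e := by
      intro a b hab
      apply hinj
      rw [← he a, ← he b, hab]
    let σ : Equiv.Perm (Fin k) := Equiv.ofBijective e (Finite.injective_iff_bijective.1 heinj)
    have : (fun b => bv (g b)) = (fun b => bv (J.orderEmbOfFin hJ b)) ∘ σ := by
      funext b
      simp only [Function.comp]
      rw [← he b]
      rfl
    rw [this, AlternatingMap.map_perm]
    have h0 := hS i J hJ (by
      intro h0
      obtain ⟨b, _, hb⟩ := Finset.mem_image.1 h0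
      exact hg b hb)
    rw [← AlternatingMap.curryLeft_apply_apply] at h0
    rcases Int.units_eq_one_or (Equiv.Perm.sign σ) with h1 | h1 <;> rw [h1] <;> simpa using h0
  · rw [AlternatingMap.map_eq_zero_of_not_injective]
    · simpa using hε
    · intro h
      apply hinj
      intro a b hab
      exact h (by simp [hab])

lemma stepB {m c k : ℕ} (A : Matrix (Fin (m + 1)) (Fin c) ℝ) (i : Fin (m + 1))
    (f : Fin k → Fin (m + 1 + c) → ℝ) (hf : ∀ b, f b (zeroIdx m c) = 0) :
    ∃ C : ℝ, ∀ (Φ : (Fin (m + 1 + c) → ℝ) [⋀^Fin (k + 1)]→ₗ[ℝ] ℝ) (ε : ℝ), 0 ≤ ε →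
      IsSmallRow A Φ ε → |Φ (Matrix.vecCons (rv A i) f)| ≤ C * ε := by
  refine ⟨∑ g : Fin k → Fin (m + 1 + c), ∏ b, |f b (g b)|, fun Φ ε hε hS => ?_⟩
  rw [← AlternatingMap.curryLeft_apply_apply]
  refine (expand_bound _ bv f f (fun b => sum_bv _)).trans ?_
  rw [Finset.sum_mul]
  refine Finset.sum_le_sum fun g _ => ?_
  by_cases hg : ∀ b, g b ≠ zeroIdx m c
  · rw [AlternatingMap.curryLeft_apply_apply]
    exact mul_le_mul_of_nonneg_left (stepA A Φ ε hε hS i g hg)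
      (Finset.prod_nonneg fun _ _ => abs_nonneg _)
  · push Not at hg
    obtain ⟨b, hb⟩ := hg
    rw [Finset.prod_eq_zero (Finset.mem_univ b)]
    · simp
    · simp [hb, hf]

/-- modified basis -/
def mb {m c : ℕ} (A : Matrix (Fin (m + 1)) (Fin c) ℝ) (τ : Fin (m + 1 + c)) :
    Fin (m + 1 + c) → ℝ := if τ = zeroIdx m c then rv A 0 else bv τ

lemma rv_zero {m c : ℕ} (A : Matrix (Fin (m + 1)) (Fin c) ℝ) (i : Fin (m + 1)) :
    rv A i (zeroIdx m c) = if i = 0 then 1 else 0 := by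
  simp only [rv, bv, rowVec, zeroIdx, Pi.add_apply, Pi.single_apply, Fin.ext_iff]
  simp [eq_comm]

lemma stepC {m c k : ℕ} (A : Matrix (Fin (m + 1)) (Fin c) ℝ) (i : Fin (m + 1))
    (g : Fin k → Fin (m + 1 + c)) :
    ∃ C : ℝ, ∀ (Φ : (Fin (m + 1 + c) → ℝ) [⋀^Fin (k + 1)]→ₗ[ℝ] ℝ) (ε : ℝ), 0 ≤ ε →
      IsSmallRow A Φ ε → |Φ (Matrix.vecCons (rv A i) (fun b => mb A (g b)))| ≤ C * ε := by
  by_cases hg : ∀ b, g b ≠ zeroIdx m c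
  · refine ⟨1, fun Φ ε hε hS => ?_⟩
    have := stepA A Φ ε hε hS i g hg
    simpa [mb, hg] using this
  push Not at hg
  obtain ⟨p, hp⟩ := hg
  by_cases hi : i = 0
  · refine ⟨0, fun Φ ε hε hS => ?_⟩
    rw [AlternatingMap.map_eq_zero_of_eq _ _ (i := 0) (j := p.succ)]
    · simp
    · simp [mb, hp, hi]
    · exact (Fin.succ_ne_zero p).symm
  by_cases hp' : ∃ p', p' ≠ p ∧ g p' = zeroIdx m c
  · obtain ⟨p', hne, hp'⟩ := hp'
    refine ⟨0, fun Φ ε hε hS => ?_⟩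
    rw [AlternatingMap.map_eq_zero_of_eq _ _ (i := p'.succ) (j := p.succ)]
    · simp
    · simp [mb, hp, hp']
    · simpa using hne
  push Not at hp'
  obtain ⟨C, hC⟩ := stepB A 0 (Function.update (fun b => mb A (g b)) p (rv A i)) (by
    intro b
    by_cases hb : b = p
    · subst hb
      simp [rv_zero, hi]
    · rw [Function.update_of_ne hb]
      simp only [mb, if_neg (hp' b hb), bv, Pi.single_apply]
      rw [if_neg (hp' b hb).symm])
  refine ⟨C, fun Φ ε hε hS => ?_⟩
  have h := hC Φ ε hε hS
  have : (Matrix.vecCons (rv A 0) (Function.update (fun b => mb A (g b)) p (rv A i)) :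
      Fin (k + 1) → Fin (m + 1 + c) → ℝ) =
      (Matrix.vecCons (rv A i) (fun b => mb A (g b)) : Fin (k + 1) → Fin (m + 1 + c) → ℝ) ∘
        Equiv.swap 0 p.succ := by
    funext x
    refine Fin.cases ?_ (fun b => ?_) x
    · simp [mb, hp]
    · by_cases hb : b = p
      · subst hb; simp
      · simp only [Matrix.cons_val_succ, Function.comp]
        rw [Equiv.swap_apply_of_ne_of_ne (Fin.succ_ne_zero b) (by simpa using hb),
          Function.update_of_ne hb]
        simp
  rw [this, AlternatingMap.map_swap _ _ (Fin.succ_ne_zero p).symm, abs_neg] at h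
  exact h

lemma stepD {m c k : ℕ} (A : Matrix (Fin (m + 1)) (Fin c) ℝ) (i : Fin (m + 1))
    (f : Fin k → Fin (m + 1 + c) → ℝ) :
    ∃ C : ℝ, ∀ (Φ : (Fin (m + 1 + c) → ℝ) [⋀^Fin (k + 1)]→ₗ[ℝ] ℝ) (ε : ℝ), 0 ≤ ε →
      IsSmallRow A Φ ε → |Φ (Matrix.vecCons (rv A i) f)| ≤ C * ε := by
  choose C hC using fun g : Fin k → Fin (m + 1 + c) => stepC A i g
  let co : Fin k → Fin (m + 1 + c) → ℝ := fun b τ =>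
    if τ = zeroIdx m c then f b (zeroIdx m c) else f b τ - f b (zeroIdx m c) * rv A 0 τ
  have hco : ∀ b, f b = ∑ τ, co b τ • mb A τ := by
    intro b
    have h1 : ∀ τ, co b τ • mb A τ = (f b τ - f b (zeroIdx m c) * rv A 0 τ) • bv τ +
        if τ = zeroIdx m c then f b (zeroIdx m c) • rv A 0 else 0 := by
      intro τ
      by_cases h : τ = zeroIdx m c
      · simp [co, mb, h, rv_zero]
      · simp [co, mb, h]
    simp only [h1, Finset.sum_add_distrib, sub_smul, Finset.sum_sub_distrib, mul_smul,
      ← Finset.smul_sum, ← sum_bv]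
    simp
  refine ⟨∑ g : Fin k → Fin (m + 1 + c), (∏ b, |co b (g b)|) * C g, fun Φ ε hε hS => ?_⟩
  rw [← AlternatingMap.curryLeft_apply_apply]
  refine (expand_bound _ (mb A) co f hco).trans ?_
  rw [Finset.sum_mul]
  refine Finset.sum_le_sum fun g _ => ?_
  rw [AlternatingMap.curryLeft_apply_apply, mul_assoc]
  exact mul_le_mul_of_nonneg_left (hC g Φ ε hε hS) (Finset.prod_nonneg fun _ _ => abs_nonneg _)

lemma stepE {m c k : ℕ} (A : Matrix (Fin (m + 1)) (Fin c) ℝ) (q : Fin (m + 1) → ℝ)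
    (f : Fin k → Fin (m + 1 + c) → ℝ) :
    ∃ C : ℝ, 0 ≤ C ∧ ∀ (Φ : (Fin (m + 1 + c) → ℝ) [⋀^Fin (k + 1)]→ₗ[ℝ] ℝ) (ε : ℝ), 0 ≤ ε →
      IsSmallRow A Φ ε → |Φ (Matrix.vecCons (∑ i, q i • rv A i) f)| ≤ C * ε := by
  choose C hC using fun i => stepD A i f
  refine ⟨|∑ i, |q i| * C i|, abs_nonneg _, fun Φ ε hε hS => ?_⟩
  refine le_trans ?_ (mul_le_mul_of_nonneg_right (le_abs_self _) hε)
  rw [map_cons_sum, Finset.sum_mul]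
  refine (Finset.abs_sum_le_sum_abs _ _).trans (Finset.sum_le_sum fun i _ => ?_)
  rw [abs_mul, mul_assoc]
  exact mul_le_mul_of_nonneg_left (hC i Φ ε hε hS) (abs_nonneg _)

section Removal

variable {t c : ℕ}

/-- the index embedding skipping `r` -/
def sg (c : ℕ) (r : Fin (t + 1 + 1)) (s : Fin (t + 1 + c)) : Fin (t + 1 + 1 + c) :=
  if (s : ℕ) < r then ⟨s, by omega⟩ else ⟨s + 1, by omega⟩

/-- the removed index -/
def rr (c : ℕ) (r : Fin (t + 1 + 1)) : Fin (t + 1 + 1 + c) := Fin.castLE (by omega) r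

lemma sg_val (r : Fin (t + 1 + 1)) (s : Fin (t + 1 + c)) :
    (sg c r s : ℕ) = if (s : ℕ) < r then (s : ℕ) else s + 1 := by
  unfold sg; split_ifs <;> rfl

lemma rr_val (r : Fin (t + 1 + 1)) : (rr c r : ℕ) = r := rfl

lemma sg_strictMono (r : Fin (t + 1 + 1)) : StrictMono (sg c r) := by
  intro a b hab
  rw [Fin.lt_def] at hab ⊢
  rw [sg_val, sg_val]
  split_ifs <;> omega

lemma sg_ne (r : Fin (t + 1 + 1)) (s : Fin (t + 1 + c)) : sg c r s ≠ rr c r := by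
  intro h
  rw [Fin.ext_iff, sg_val, rr_val] at h
  split_ifs at h <;> omega

lemma sg_surj (r : Fin (t + 1 + 1)) (u : Fin (t + 1 + 1 + c)) (hu : u ≠ rr c r) :
    ∃ s, sg c r s = u := by
  have hu' : (u : ℕ) ≠ r := fun h => hu (Fin.ext h)
  have h1 := u.2
  have h2 := r.2
  by_cases h : (u : ℕ) < r
  · refine ⟨⟨u, by omega⟩, Fin.ext ?_⟩
    rw [sg_val]; simp [h]
  · refine ⟨⟨u - 1, by omega⟩, Fin.ext ?_⟩
    rw [sg_val]; simp only; split_ifs <;> omega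

/-- as an embedding -/
def sgE (c : ℕ) (r : Fin (t + 1 + 1)) : Fin (t + 1 + c) ↪ Fin (t + 1 + 1 + c) :=
  ⟨sg c r, (sg_strictMono r).injective⟩

lemma sum_sg (r : Fin (t + 1 + 1)) (F : Fin (t + 1 + 1 + c) → ℝ) :
    ∑ u, F u = ∑ s, F (sg c r s) + F (rr c r) := by
  have h : (Finset.univ : Finset (Fin (t + 1 + 1 + c))) =
      insert (rr c r) (Finset.univ.map (sgE c r)) := by
    ext u
    simp only [Finset.mem_univ, Finset.mem_insert, Finset.mem_map, true_and, true_iff]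
    by_cases hu : u = rr c r
    · exact Or.inl hu
    · exact Or.inr (sg_surj r u hu)
  rw [h, Finset.sum_insert, Finset.sum_map, add_comm]
  · rfl
  · simp only [Finset.mem_map, not_exists, Finset.mem_univ, true_and]
    exact fun s => sg_ne r s

lemma sg_le_iff (r : Fin (t + 1 + 1)) (s : Fin (t + 1 + c)) :
    t + 1 + 1 ≤ (sg c r s : ℕ) ↔ t + 1 ≤ (s : ℕ) := by
  rw [sg_val]; split_ifs <;> omega

lemma rowVec_sg (A : Matrix (Fin (t + 1 + 1)) (Fin c) ℝ) (r i : Fin (t + 1 + 1))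
    (s : Fin (t + 1 + c)) :
    rowVec A i (sg c r s) = if h : t + 1 ≤ (s : ℕ) then A i ⟨(s : ℕ) - (t + 1), by omega⟩ else 0 := by
  unfold rowVec
  by_cases h : t + 1 ≤ (s : ℕ)
  · rw [dif_pos ((sg_le_iff r s).2 h), dif_pos h]
    congr 1
    apply Fin.ext
    simp only [sg_val]
    split_ifs <;> omega
  · rw [dif_neg (fun h' => h ((sg_le_iff r s).1 h')), dif_neg h]

lemma rowVec_rr (A : Matrix (Fin (t + 1 + 1)) (Fin c) ℝ) (r i : Fin (t + 1 + 1)) :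
    rowVec A i (rr c r) = 0 := by
  unfold rowVec
  rw [dif_neg]
  rw [rr_val]; omega

lemma sg_castLE (r : Fin (t + 1 + 1)) (i : Fin (t + 1)) :
    sg c r (Fin.castLE (by omega) i) = Fin.castLE (by omega) (r.succAbove i) := by
  apply Fin.ext
  rw [sg_val]
  simp only [Fin.val_castLE, Fin.succAbove, Fin.lt_def, Fin.val_castSucc]
  split_ifs <;> simp

lemma rv_sg (A : Matrix (Fin (t + 1 + 1)) (Fin c) ℝ) (r : Fin (t + 1 + 1)) (i : Fin (t + 1))
    (s : Fin (t + 1 + c)) :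
    rv A (r.succAbove i) (sg c r s) = rv (Matrix.of fun i => A (r.succAbove i)) i s := by
  simp only [rv, Pi.add_apply, rowVec_sg]
  rw [← sg_castLE]
  simp only [bv, Pi.single_apply, (sg_strictMono r).injective.eq_iff]
  rfl

lemma rv_rr (A : Matrix (Fin (t + 1 + 1)) (Fin c) ℝ) (r : Fin (t + 1 + 1)) (i : Fin (t + 1)) :
    rv A (r.succAbove i) (rr c r) = 0 := by
  simp only [rv, Pi.add_apply, rowVec_rr]
  rw [← sg_castLE]
  simp [bv, Pi.single_apply, (sg_ne r _).symm]

lemma norm_sg (r : Fin (t + 1 + 1)) (a : ℝ) (w : Finset (Fin (t + 1 + 1 + c)) → ℝ)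
    (w' : Finset (Fin (t + 1 + c)) → ℝ) (h : ∀ I, w (I.map (sgE c r)) = a * w' I) :
    normL (piBullet (t + 1) w) = |a| * normL (piBullet t w') := by
  unfold normL
  rw [← Real.sqrt_sq_eq_abs, ← Real.sqrt_mul (sq_nonneg a), Finset.mul_sum]
  congr 1
  symm
  refine Finset.sum_of_injOn (fun I => I.map (sgE c r)) ?_ ?_ ?_ ?_
  · exact (Finset.map_injective (sgE c r)).injOn
  · intro I _; simp
  · intro I _ hI
    simp only [piBullet]
    rw [if_neg]
    · simp
    · intro hall
      apply hI
      have : ∀ u ∈ I, ∃ s, sg c r s = u := by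
        intro u hu
        apply sg_surj
        rintro rfl
        have := hall _ hu
        rw [rr_val] at this
        omega
      refine ⟨Finset.univ.filter (fun s => sg c r s ∈ I), by simp, ?_⟩
      ext u
      simp only [Finset.mem_map, Finset.mem_filter, Finset.mem_univ, true_and]
      constructor
      · rintro ⟨s, hs, rfl⟩; exact hs
      · intro hu
        obtain ⟨s, rfl⟩ := this u hu
        exact ⟨s, hu, rfl⟩
  · intro I _
    simp only [piBullet, h]
    have : (∀ u ∈ I.map (sgE c r), t + 1 + 1 ≤ (u : ℕ)) ↔ ∀ s ∈ I, t + 1 ≤ (s : ℕ) := by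
      simp only [Finset.mem_map, forall_exists_index, and_imp, forall_apply_eq_imp_iff₂]
      exact forall₂_congr fun s _ => sg_le_iff r s
    simp only [this]
    split_ifs
    · ring
    · simp

lemma ord_map (r : Fin (t + 1 + 1)) {j : ℕ} (I : Finset (Fin (t + 1 + c))) (h : I.card = j)
    (h' : (I.map (sgE c r)).card = j) (b : Fin j) :
    (I.map (sgE c r)).orderEmbOfFin h' b = sg c r (I.orderEmbOfFin h b) := by
  have := Finset.orderEmbOfFin_unique h' (f := fun b => sg c r (I.orderEmbOfFin h b))
    (fun x => Finset.mem_map_of_mem (sgE c r) (Finset.orderEmbOfFin_mem I h x))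
    (fun x y hxy => sg_strictMono r ((I.orderEmbOfFin h).strictMono hxy))
  exact (congrFun this b).symm

lemma plu_map (r : Fin (t + 1 + 1)) {j : ℕ} (D : ℤ) (v : Fin j → Fin (t + 1 + 1 + c) → ℤ)
    (v' : Fin j → Fin (t + 1 + c) → ℤ) (h : ∀ a s, v a (sg c r s) = D * v' a s)
    (I : Finset (Fin (t + 1 + c))) :
    plu v (I.map (sgE c r)) = (D : ℝ) ^ j * plu v' I := by
  by_cases hI : I.card = j
  · have hI' : (I.map (sgE c r)).card = j := by rw [Finset.card_map, hI]
    rw [plu_eq v _ hI', plu_eq v' _ hI, Phi_bv, Phi_bv]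
    have := Matrix.det_smul (Matrix.of fun a b : Fin j => (v' a (I.orderEmbOfFin hI b) : ℝ)) (D : ℝ)
    rw [Fintype.card_fin] at this
    rw [← this]
    congr 1
    ext a b
    simp [ord_map r I hI hI', h]
  · have hI' : ¬ (I.map (sgE c r)).card = j := by rwa [Finset.card_map]
    simp [plu, hI]

end Removal

lemma li_of_norm {N j m : ℕ} (v : Fin j → Fin N → ℤ) (h : 0 < normL (piBullet m (plu v))) :
    LinearIndependent ℤ v := by
  have : ∃ I, plu v I ≠ 0 := by
    by_contra hcon
    push Not at hcon
    have : normL (piBullet m (plu v)) = 0 := by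
      simp [normL, piBullet, hcon]
    exact h.ne' this
  obtain ⟨I, hI⟩ := this
  have hc : I.card = j := by
    by_contra hc
    exact hI (by simp [plu, hc])
  rw [plu_eq v I hc, Phi_bv] at hI
  have h1 : (Matrix.of fun a b : Fin j => v a (I.orderEmbOfFin hc b)).det ≠ 0 := by
    intro h0
    apply hI
    have := congrArg (Int.cast : ℤ → ℝ) h0
    rw [Int.cast_zero, ← eq_intCast (Int.castRingHom ℝ), RingHom.map_det] at this
    exact this
  have h2 := Matrix.linearIndependent_rows_of_det_ne_zero h1
  exact LinearIndependent.of_comp (LinearMap.funLeft ℤ ℤ (I.orderEmbOfFin hc)) h2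

lemma represents_iff {N j : ℕ} (w : Finset (Fin N) → ℝ) :
    Represents j w ↔ ∃ v : Fin j → (Fin N → ℤ), LinearIndependent ℤ v ∧ w = plu v := by
  constructor
  · rintro ⟨v, hv, hw⟩
    exact ⟨v, hv, funext hw⟩
  · rintro ⟨v, hv, rfl⟩
    exact ⟨v, hv, fun I => rfl⟩

lemma Phi_transfer {N N' j : ℕ} (v : Fin j → Fin N → ℤ) (v' : Fin j → Fin N' → ℤ)
    (T : (Fin N → ℝ) → (Fin N' → ℝ))
    (hT : ∀ x a, ∑ u, (v a u : ℝ) * x u = ∑ s, (v' a s : ℝ) * T x s) (f : Fin j → Fin N → ℝ) :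
    Phi v f = Phi v' (fun b => T (f b)) := by
  rw [Phi_apply, Phi_apply]
  congr 1
  ext a b
  exact hT _ _

/-- The set of admissible exponents. -/
def Adm (m c : ℕ) (A : Matrix (Fin (m + 1)) (Fin c) ℝ) (j : ℕ) (v : ℝ) : Prop :=
  ∀ M : ℝ, 0 < M →
    ∃ w : Finset (Fin (m + 1 + c)) → ℝ, Represents j w ∧ M < normL (piBullet m w) ∧
      ∀ (i : Fin (m + 1)) (J : Finset (Fin (m + 1 + c))), zeroIdx m c ∉ J →
        J.card = j - 1 →
        |rowCoeff A i J w| < (normL (piBullet m w)) ^ (-((v + 1 - (j : ℝ)) / j))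

lemma adm_remove {t c : ℕ} (A : Matrix (Fin (t + 1 + 1)) (Fin c) ℝ) (r : Fin (t + 1 + 1)) (k : ℕ)
    (e : ℝ) (h : Adm (t + 1) c A (k + 1) e) :
    Adm t c (Matrix.of fun i => A (r.succAbove i)) (k + 1) e := by
  intro M hM
  obtain ⟨w, hw, hwM, hwA⟩ := h M hM
  obtain ⟨v, hv, rfl⟩ := (represents_iff w).1 hw
  let v' : Fin (k + 1) → Fin (t + 1 + c) → ℤ := fun a s => v a (sg c r s)
  have hn : normL (piBullet (t + 1) (plu v)) = normL (piBullet t (plu v')) := by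
    have := norm_sg r ((1 : ℤ) ^ (k + 1) : ℝ) (plu v) (plu v') (plu_map r 1 v v' (by simp [v']))
    simpa using this
  rw [hn] at hwM hwA
  refine ⟨plu v', (represents_iff _).2 ⟨v', li_of_norm v' (hM.trans hwM), rfl⟩, hwM, ?_⟩
  intro i J hJ0 hJ
  simp only [Nat.add_sub_cancel] at hJ
  have hJ' : (J.map (sgE c r)).card = k := by rw [Finset.card_map, hJ]
  have h1 := hwA (r.succAbove i) (J.map (sgE c r)) (by
    intro h0
    obtain ⟨s, hs, hs0⟩ := Finset.mem_map.1 h0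
    apply hJ0
    have : s = zeroIdx t c := by
      apply Fin.ext
      have := congrArg Fin.val hs0
      change (sg c r s : ℕ) = 0 at this
      rw [sg_val] at this
      change (s : ℕ) = 0
      split_ifs at this
      exact this
    exact this ▸ hs) (by simpa using hJ')
  convert h1 using 2
  rw [row_eq _ _ _ _ hJ, row_eq _ _ _ _ hJ']
  rw [Phi_transfer v' v (fun x u => ∑ s, x s * bv (sg c r s) u)]
  · congr 1
    funext b
    refine Fin.cases ?_ (fun b => ?_) b
    · simp only [Matrix.cons_val_zero]
      funext u
      by_cases hu : u = rr c r
      · subst hu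
        rw [rv_rr]
        simp [bv, Pi.single_apply, (sg_ne r _).symm]
      · obtain ⟨s, rfl⟩ := sg_surj r u hu
        rw [rv_sg]
        simp [bv, Pi.single_apply, (sg_strictMono r).injective.eq_iff]
    · simp only [Matrix.cons_val_succ]
      rw [ord_map r J hJ hJ']
      funext u
      rw [Finset.sum_eq_single (J.orderEmbOfFin hJ b)]
      · simp [bv]
      · intro s _ hs
        simp [bv, Pi.single_apply, hs]
      · simp
  · intro x a
    simp only [Finset.mul_sum]
    rw [Finset.sum_comm]
    refine Finset.sum_congr rfl fun s _ => ?_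
    simp [bv, Pi.single_apply, v']

lemma adm_add {t c : ℕ} (A : Matrix (Fin (t + 1 + 1)) (Fin c) ℝ) (r : Fin (t + 1 + 1)) (k : ℕ)
    (q : Fin (t + 1) → ℚ) (hq : ∀ k : Fin c, A r k = ∑ i, (q i : ℝ) * A (r.succAbove i) k)
    (e e' : ℝ) (he : e' < e)
    (h : Adm t c (Matrix.of fun i => A (r.succAbove i)) (k + 1) e) :
    Adm (t + 1) c A (k + 1) e' := by
  set A' : Matrix (Fin (t + 1)) (Fin c) ℝ := Matrix.of fun i => A (r.succAbove i) with hA'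
  obtain ⟨D, hD, p, hp⟩ : ∃ D : ℤ, 1 ≤ D ∧ ∃ p : Fin (t + 1) → ℤ, ∀ i, (p i : ℝ) = D * q i := by
    refine ⟨∏ i, ((q i).den : ℤ), ?_, fun i => (∏ l ∈ Finset.univ.erase i, ((q l).den : ℤ)) *
      (q i).num, ?_⟩
    · have : 0 < ∏ i, ((q i).den : ℤ) := Finset.prod_pos fun i _ => by exact_mod_cast (q i).den_pos
      omega
    · intro i
      rw [← Finset.mul_prod_erase _ _ (Finset.mem_univ i)]
      push_cast
      have h1 : ((q i).den : ℝ) * (q i : ℝ) = (q i).num := by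
        exact_mod_cast Rat.den_mul_eq_num (q i)
      rw [← h1]; ring
  let T : (Fin (t + 1 + 1 + c) → ℝ) → (Fin (t + 1 + c) → ℝ) := fun x s =>
    D * x (sg c r s) + x (rr c r) * ∑ i, (p i : ℝ) * bv (Fin.castLE (by omega) i) s
  have hT : ∀ i, ∃ co : Fin (t + 1) → ℝ, T (rv A i) = ∑ l, co l • rv A' l := by
    intro i
    by_cases hi : i = r
    · subst hi
      refine ⟨fun l => p l, ?_⟩
      funext s
      have e1 : rv A i (rr c i) = 1 := by
        simp only [rv, Pi.add_apply, rowVec_rr, bv]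
        simp [rr]
      have e2 : bv (Fin.castLE (by omega) i : Fin (t + 1 + 1 + c)) (sg c i s) = 0 := by
        have := sg_ne i s
        simp only [bv, Pi.single_apply]
        rw [if_neg]
        exact this
      have e3 : (D : ℝ) * rowVec A i (sg c i s) = ∑ l, (p l : ℝ) * rowVec A' l s := by
        rw [rowVec_sg]
        unfold rowVec
        split_ifs
        · rw [hq, Finset.mul_sum]
          refine Finset.sum_congr rfl fun l _ => ?_
          rw [hp, hA', mul_assoc]
          rfl
        · simp
      simp only [T, e1, one_mul]
      simp only [rv, Pi.add_apply, e2, zero_add, e3, Finset.sum_apply, Pi.smul_apply, smul_eq_mul,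
        mul_add, Finset.sum_add_distrib]
      ring
    · obtain ⟨l, rfl⟩ := Fin.exists_succAbove_eq hi
      refine ⟨Pi.single l (D : ℝ), ?_⟩
      funext s
      rw [Finset.sum_apply, Finset.sum_eq_single l]
      · simp [T, rv_rr, rv_sg, hA']
      · intro l' _ hl
        simp [hl]
      · simp
  have hC : ∀ (i : Fin (t + 1 + 1)) (g : Fin k → Fin (t + 1 + 1 + c)), ∃ C : ℝ, 0 ≤ C ∧
      ∀ (Φ : (Fin (t + 1 + c) → ℝ) [⋀^Fin (k + 1)]→ₗ[ℝ] ℝ) (ε : ℝ), 0 ≤ ε →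
      IsSmallRow A' Φ ε → |Φ (Matrix.vecCons (T (rv A i)) (fun b => T (bv (g b))))| ≤ C * ε := by
    intro i g
    obtain ⟨co, hco⟩ := hT i
    rw [hco]
    exact stepE A' co _
  choose C hC0 hC using hC
  let K : ℝ := ∑ i, ∑ g, C i g
  have hK : ∀ i g, C i g ≤ K := fun i g =>
    (Finset.single_le_sum (f := fun g => C i g) (fun g _ => hC0 i g) (Finset.mem_univ g)).trans
      (Finset.single_le_sum (f := fun i => ∑ g, C i g)
        (fun i _ => Finset.sum_nonneg fun g _ => hC0 i g) (Finset.mem_univ i))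
  set α : ℝ := (e + 1 - ((k + 1 : ℕ) : ℝ)) / ((k + 1 : ℕ) : ℝ) with hα
  set β : ℝ := (e' + 1 - ((k + 1 : ℕ) : ℝ)) / ((k + 1 : ℕ) : ℝ) with hβ
  have hδ : 0 < α - β := by
    have : (0 : ℝ) < ((k + 1 : ℕ) : ℝ) := by positivity
    rw [hα, hβ, ← sub_div]
    apply div_pos _ this
    linarith
  have hDr : (1 : ℝ) ≤ D := by exact_mod_cast hD
  set E : ℝ := (D : ℝ) ^ (k + 1) with hE
  have hE1 : 1 ≤ E := one_le_pow₀ hDr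
  have hE0 : 0 < E := by linarith
  have hlarge : ∃ M0 : ℝ, ∀ X, M0 < X → K / E ^ (-β) < X ^ (α - β) := by
    have := (tendsto_rpow_atTop hδ).eventually_gt_atTop (K / E ^ (-β))
    obtain ⟨M0, hM0⟩ := Filter.eventually_atTop.1 this
    exact ⟨M0, fun X hX => hM0 X hX.le⟩
  obtain ⟨M0, hM0⟩ := hlarge
  intro M hM
  obtain ⟨w, hw, hwM, hwA⟩ := h (max M M0) (lt_max_of_lt_left hM)
  obtain ⟨v', hv', rfl⟩ := (represents_iff w).1 hw
  set X := normL (piBullet t (plu v')) with hX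
  have hXM : M < X := (le_max_left _ _).trans_lt hwM
  have hX0 : 0 < X := hM.trans hXM
  let v : Fin (k + 1) → Fin (t + 1 + 1 + c) → ℤ := fun a =>
    Function.extend (sg c r) (fun s => D * v' a s)
      (fun _ => ∑ i, p i * v' a (Fin.castLE (by omega) i))
  have hv1 : ∀ a s, v a (sg c r s) = D * v' a s := fun a s =>
    (sg_strictMono r).injective.extend_apply _ _ _
  have hv2 : ∀ a, v a (rr c r) = ∑ i, p i * v' a (Fin.castLE (by omega) i) := fun a =>
    Function.extend_apply' _ _ _ (fun ⟨s, hs⟩ => sg_ne r s hs)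
  have hn : normL (piBullet (t + 1) (plu v)) = E * X := by
    rw [norm_sg r _ (plu v) (plu v') (plu_map r D v v' hv1), abs_of_pos hE0]
  have hXE : X ≤ E * X := by nlinarith
  refine ⟨plu v, (represents_iff _).2 ⟨v, li_of_norm (m := t + 1) v ?_, rfl⟩, ?_, ?_⟩
  · rw [hn]; positivity
  · rw [hn]; linarith
  intro i J hJ0 hJ
  simp only [Nat.add_sub_cancel] at hJ
  rw [hn, row_eq _ _ _ _ hJ, Phi_transfer v v' T]
  · have e1 : (fun b => T ((Matrix.vecCons (rv A i) (fun b => bv (J.orderEmbOfFin hJ b)) :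
        Fin (k + 1) → Fin (t + 1 + 1 + c) → ℝ) b)) =
        Matrix.vecCons (T (rv A i)) (fun b => T (bv (J.orderEmbOfFin hJ b))) := by
      funext b
      refine Fin.cases ?_ (fun b => ?_) b <;> simp
    rw [e1]
    have hsmall : IsSmallRow A' (Phi v') (X ^ (-α)) := by
      intro i J hJ hJ0
      rw [← row_eq]
      exact (hwA i J hJ0 (by simpa using hJ)).le
    have hpos : 0 < X ^ (-α) := Real.rpow_pos_of_pos hX0 _
    refine (hC i _ (Phi v') (X ^ (-α)) hpos.le hsmall).trans_lt ?_
    refine (mul_le_mul_of_nonneg_right (hK i _) hpos.le).trans_lt ?_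
    have h2 := hM0 X ((le_max_right _ _).trans_lt hwM)
    have hEb : 0 < E ^ (-β) := Real.rpow_pos_of_pos hE0 _
    rw [div_lt_iff₀ hEb] at h2
    rw [Real.mul_rpow hE0.le hX0.le]
    have h3 : X ^ (-β) = X ^ (α - β) * X ^ (-α) := by
      rw [← Real.rpow_add hX0]; congr 1; ring
    rw [h3]
    calc K * X ^ (-α) < (X ^ (α - β) * E ^ (-β)) * X ^ (-α) := mul_lt_mul_of_pos_right h2 hpos
      _ = _ := by ring
  · intro x a
    rw [sum_sg r]
    simp only [hv1, hv2, T, mul_add, Finset.sum_add_distrib]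
    congr 1
    · refine Finset.sum_congr rfl fun s _ => ?_
      push_cast; ring
    · push_cast
      simp only [Finset.mul_sum]
      rw [Finset.sum_comm, Finset.sum_mul]
      refine Finset.sum_congr rfl fun l _ => ?_
      simp [bv, Pi.single_apply]
      ring

end

/-- Lemma 5.7: if `A'` is obtained from `A ∈ M_{t+2,c}(ℝ)` by removing one of its rows,
then `ω_j(A') ≥ ω_j(A)` for all `j`; and if moreover the removed row is a rational linear
combination of the remaining rows, then `ω_j(A') = ω_j(A)` for all `j`. -/
theorem omegaHigher_remove_row {t c : ℕ} (A : Matrix (Fin (t + 1 + 1)) (Fin c) ℝ)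
    (r : Fin (t + 1 + 1)) :
    (∀ j : ℕ, 1 ≤ j → j ≤ c →
      omegaHigher t c (Matrix.of fun i => A (r.succAbove i)) j ≥ omegaHigher (t + 1) c A j) ∧
    ((∃ q : Fin (t + 1) → ℚ, ∀ k : Fin c, A r k = ∑ i, (q i : ℝ) * A (r.succAbove i) k) →
      ∀ j : ℕ, 1 ≤ j → j ≤ c →
        omegaHigher t c (Matrix.of fun i => A (r.succAbove i)) j = omegaHigher (t + 1) c A j) := by
  have h1 : ∀ j : ℕ, 1 ≤ j → j ≤ c →
      omegaHigher t c (Matrix.of fun i => A (r.succAbove i)) j ≥ omegaHigher (t + 1) c A j := by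
    intro j hj _
    obtain ⟨k, rfl⟩ : ∃ k, j = k + 1 := ⟨j - 1, by omega⟩
    apply sSup_le_sSup
    rintro x ⟨v, rfl, hv⟩
    exact ⟨v, rfl, adm_remove A r k v hv⟩
  refine ⟨h1, ?_⟩
  rintro ⟨q, hq⟩ j hj hjc
  refine le_antisymm ?_ (h1 j hj hjc)
  obtain ⟨k, rfl⟩ : ∃ k, j = k + 1 := ⟨j - 1, by omega⟩
  apply sSup_le
  rintro x ⟨v, rfl, hv⟩
  apply ENNReal.le_of_forall_pos_le_add
  intro ε hε _
  have h2 : ENNReal.ofReal (v - ε) ≤ omegaHigher (t + 1) c A (k + 1) :=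
    le_sSup ⟨v - ε, rfl, adm_add A r k q hq v (v - ε)
      (by have : (0 : ℝ) < ε := hε
          linarith) hv⟩
  calc ENNReal.ofReal v = ENNReal.ofReal ((v - ε) + ε) := by rw [sub_add_cancel]
    _ ≤ ENNReal.ofReal (v - ε) + ENNReal.ofReal ε := ENNReal.ofReal_add_le
    _ ≤ _ := by
      rw [ENNReal.ofReal_coe_nnreal]
      gcongr
end

section
/- Quantitative nondivergence with rank-dependent lower bounds: Let d, k ∈ ℕ, C, α, ρ > 0, B = B(x₀, r) ⊆ ℝ^d a ball, B̃ = B(x₀, 3^k r), and h: B̃ → SL_k(ℝ) a map such that (i) for every subgroup Γ ⊆ ℤ^k, the function x ↦ ‖h(x)Γ‖ (covolume of h(x)Γ) is (C, α)-good on B̃, and (ii) for every subgroup Γ ⊆ ℤ^k, sup_{x ∈ B} ‖h(x)Γ‖ ≥ ρ^{rk(Γ)}. Then for every 0 < ε ≤ ρ, λ({x ∈ B : h(x)ℤ^k ∉ K_ε}) ≤ const(d,k) · C · (ε/ρ)^α · λ(B), where K_ε is the set of unimodular lattices with no nonzero vector of norm < ε and λ is Lebesgue measure. -/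
open MeasureTheory Metric Matrix

/-- The covolume of the discrete subgroup `g·Γ ⊆ ℝ^k`, where `Γ ⊆ ℤ^k` is the subgroup
with `ℤ`-basis `v : Fin r → ℤ^k`: the square root of the Gram determinant of the vectors
`g v₁, …, g v_r` (equal to `1` when `r = 0`). -/
noncomputable def covolImg {k r : ℕ} (g : Matrix (Fin k) (Fin k) ℝ)
    (v : Fin r → Fin k → ℤ) : ℝ :=
  Real.sqrt (Matrix.det (Matrix.of fun a b : Fin r =>
    ∑ i, (g.mulVec fun t => ((v a t : ℤ) : ℝ)) i * (g.mulVec fun t => ((v b t : ℤ) : ℝ)) i))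

/-- `f` is `(C, α)`-good on `U ⊆ ℝ^d` (with respect to Lebesgue measure): for every ball
`B ⊆ U` and `ε > 0`, `λ {x ∈ B : |f x| < ε} ≤ C (ε / sup_B |f|)^α λ(B)`. -/
def IsGood {d : ℕ} (C α : ℝ) (U : Set (Fin d → ℝ)) (f : (Fin d → ℝ) → ℝ) : Prop :=
  ∀ (z : Fin d → ℝ) (r : ℝ), 0 < r → ball z r ⊆ U → ∀ ε : ℝ, 0 < ε →
    volume {x ∈ ball z r | |f x| < ε} ≤
      ENNReal.ofReal (C * (ε / sSup ((fun x => |f x|) '' ball z r)) ^ α) *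
        volume (ball z r)


/-- constants of the induction -/
def qndConst (D : ℕ) : ℕ → ℕ
  | 0 => 0
  | n + 1 => D * (1 + qndConst D n)

/-- `ψ` approaches the value `a` on the ball. -/
def qndBig {d : ℕ} (ψ : (Fin d → ℝ) → ℝ) (a : ℝ) (z : Fin d → ℝ) (s : ℝ) : Prop :=
  ∀ η < a, ∃ x ∈ ball z s, η < ψ x

/-- the protected points -/
def qndProt {d : ℕ} {P : Type*} [PartialOrder P] (ψ : P → (Fin d → ℝ) → ℝ) (a b : P → ℝ)
    (Q : Set P) (x : Fin d → ℝ) : Prop :=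
  ∃ F : Finset P, (∀ V ∈ F, V ∈ Q) ∧ IsChain (· ≤ ·) (F : Set P) ∧ (∀ V ∈ F, ψ V x ≤ a V) ∧
    ∀ V ∈ Q, (∀ W ∈ F, V ≤ W ∨ W ≤ V) → b V ≤ ψ V x

lemma qndBig_mono {d : ℕ} {ψ : (Fin d → ℝ) → ℝ} {a : ℝ} {z z' : Fin d → ℝ} {s s' : ℝ}
    (h : ball z s ⊆ ball z' s') (hb : qndBig ψ a z s) : qndBig ψ a z' s' := by
  intro η hη
  obtain ⟨x, hx, hx'⟩ := hb η hη
  exact ⟨x, h hx, hx'⟩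

lemma not_qndBig {d : ℕ} {ψ : (Fin d → ℝ) → ℝ} {a : ℝ} {z : Fin d → ℝ} {s : ℝ}
    (hb : ¬ qndBig ψ a z s) : ∀ x ∈ ball z s, ψ x ≤ a := by
  intro x hx
  unfold qndBig at hb
  push Not at hb
  obtain ⟨η, hη, h⟩ := hb
  exact (h x hx).trans hη.le

lemma qnd_vol_scale {d : ℕ} (x y : Fin d → ℝ) {s : ℝ} (hs : 0 < s) (m : ℕ) (hm : 0 < m) :
    volume (ball x ((m : ℝ) * s)) = (m ^ d : ℕ) * volume (ball y s) := by
  have hm' : (0 : ℝ) < m := by exact_mod_cast hm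
  rw [Real.volume_pi_ball _ (by positivity), Real.volume_pi_ball _ hs,
    ← ENNReal.ofReal_natCast, ← ENNReal.ofReal_mul (by positivity)]
  congr 1
  push_cast
  simp only [Fintype.card_fin]
  ring

/-- choice of the ball and element at an unprotected point -/
lemma qnd_choose {d : ℕ} {P : Type*} [PartialOrder P] (ψ : P → (Fin d → ℝ) → ℝ) (a b : P → ℝ)
    (Q : Set P) (z : Fin d → ℝ) (s : ℝ) (x : Fin d → ℝ) (hx : x ∈ ball z s)
    (hN : ∀ V, ψ V x < b V → ∃ s > 0, ¬ qndBig (ψ V) (a V) x s)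
    (hQ : ∀ V ∈ Q, qndBig (ψ V) (a V) z s)
    (hp : ¬ qndProt ψ a b Q x) :
    ∃ R : ℝ, ∃ V ∈ Q, 0 < R ∧ R < 2 * s ∧ (∀ y ∈ closedBall x (R / 2), ψ V y ≤ a V) ∧
      ∀ W ∈ Q, qndBig (ψ W) (a W) x R := by
  have h1 : ∃ V ∈ Q, ψ V x < b V := by
    by_contra! hc
    exact hp ⟨∅, by simp, by simp, by simp, fun V hV _ => hc V hV⟩
  obtain ⟨V0, hV0, hlt⟩ := h1
  obtain ⟨s0, hs0, hnb⟩ := hN V0 hlt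
  set S : Set ℝ := {t | ∃ V ∈ Q, ¬ qndBig (ψ V) (a V) x t} with hS
  have hS0 : s0 ∈ S := ⟨V0, hV0, hnb⟩
  have hxz : dist x z < s := hx
  have hub : ∀ t ∈ S, t ≤ s + dist x z := by
    rintro t ⟨V, hV, hn⟩
    by_contra! hc
    apply hn
    refine qndBig_mono (ball_subset_ball' ?_) (hQ V hV)
    rw [dist_comm]; exact hc.le
  have hbdd : BddAbove S := ⟨_, hub⟩
  have hR0 : 0 < sSup S := lt_of_lt_of_le hs0 (le_csSup hbdd hS0)
  have hR2 : sSup S < 2 * s := by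
    have := csSup_le ⟨s0, hS0⟩ hub
    linarith
  obtain ⟨R, hR, hR'⟩ := exists_between (lt_min hR2 (by linarith : sSup S < 2 * sSup S))
  have hR'1 := lt_of_lt_of_le hR' (min_le_left _ _)
  have hR'2 := lt_of_lt_of_le hR' (min_le_right _ _)
  obtain ⟨s1, ⟨V, hV, hVn⟩, hs1⟩ := exists_lt_of_lt_csSup ⟨s0, hS0⟩ (by linarith : R / 2 < sSup S)
  refine ⟨R, V, hV, by linarith, hR'1, ?_, ?_⟩
  · intro y hy
    exact not_qndBig hVn y (closedBall_subset_ball hs1 hy)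
  · intro W hW
    by_contra hc
    exact absurd (le_csSup hbdd (show R ∈ S from ⟨W, hW, hc⟩)) (by linarith)

theorem qnd_induct {d : ℕ} {P : Type*} [PartialOrder P] [Nonempty P] (ψ : P → (Fin d → ℝ) → ℝ) (a b : P → ℝ)
    (T N : Set (Fin d → ℝ)) (K : ENNReal)
    (hG : ∀ V z s, 0 < s → ball z s ⊆ T → qndBig (ψ V) (a V) z s →
      volume {x ∈ ball z s | ψ V x < b V} ≤ K * volume (ball z s))
    (hN : ∀ x ∈ T, x ∉ N → ∀ V, ψ V x < b V → ∃ s > 0, ¬ qndBig (ψ V) (a V) x s) (n : ℕ) :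
    ∀ (Q : Set P) (z : Fin d → ℝ) (s : ℝ), 0 < s → ball z (3 ^ n * s) ⊆ T →
      (∀ V ∈ Q, qndBig (ψ V) (a V) z s) →
      (∀ F : Finset P, (∀ V ∈ F, V ∈ Q) → IsChain (· ≤ ·) (F : Set P) → F.card ≤ n) →
      volume {x ∈ ball z s | x ∉ N ∧ ¬ qndProt ψ a b Q x} ≤
        (qndConst (30 ^ d) n : ENNReal) * K * volume (ball z s) := by
  classical
  induction n with
  | zero =>
    intro Q z s hs hT hQ hch
    have : {x ∈ ball z s | x ∉ N ∧ ¬ qndProt ψ a b Q x} = ∅ := by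
      ext x
      simp only [Set.mem_ofPred_eq, Set.mem_empty_iff_false, iff_false, not_and, not_not]
      intro _ _
      refine ⟨∅, by simp, by simp, by simp, fun V hV _ => ?_⟩
      have := hch {V} (by simpa using hV) (by simp)
      simp at this
    rw [this]; simp
  | succ n ih =>
    intro Q z s hs hT hQ hch
    set E := {x ∈ ball z s | x ∉ N ∧ ¬ qndProt ψ a b Q x} with hE
    have h3 : (1 : ℝ) ≤ 3 ^ n := one_le_pow₀ (by norm_num)
    have hch1 : ∀ x ∈ E, ∃ R : ℝ, ∃ V ∈ Q, 0 < R ∧ R < 2 * s ∧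
        (∀ y ∈ closedBall x (R / 2), ψ V y ≤ a V) ∧ ∀ W ∈ Q, qndBig (ψ W) (a W) x R := by
      rintro x ⟨hx, hxN, hxp⟩
      refine qnd_choose ψ a b Q z s x hx (hN x (hT ?_) hxN) hQ hxp
      refine ball_subset_ball ?_ hx
      rw [pow_succ]; nlinarith
    choose! R V hVQ hR0 hR2 hsm hbig using hch1
    obtain ⟨u, huE, hudisj, hucov⟩ := Vitali.exists_disjoint_subfamily_covering_enlargement_closedBall
      E (fun x => x) (fun x => R x / 10) (2 * s / 10) (fun x hx => by linarith [hR2 x hx]) 5 (by norm_num)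
    have hucount : u.Countable := by
      refine hudisj.countable_of_nonempty_interior fun x hx => ?_
      refine ⟨x, ball_subset_interior_closedBall (mem_ball_self ?_)⟩
      linarith [hR0 x (huE hx)]
    have hcover : E ⊆ ⋃ x ∈ u, (E ∩ closedBall x (R x / 2)) := by
      intro y hy
      obtain ⟨x, hx, hsub⟩ := hucov y hy
      simp only [Set.mem_iUnion]
      refine ⟨x, hx, hy, ?_⟩
      have := hsub (mem_closedBall_self (by linarith [hR0 y hy]))
      convert this using 2
      ring
    have hballT : ∀ x ∈ E, ball x (3 ^ n * R x) ⊆ T := by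
      intro x hx
      refine (ball_subset_ball' ?_).trans hT
      have h1 : dist x z < s := hx.1
      have h2 := hR2 x hx
      rw [pow_succ]
      nlinarith
    have hpiece : ∀ x ∈ E, volume (E ∩ closedBall x (R x / 2)) ≤
        ((1 + qndConst (30 ^ d) n : ℕ) : ENNReal) * K * volume (ball x (R x)) := by
      intro x hx
      set Q' : Set P := {W | W ∈ Q ∧ W ≠ V x ∧ (W ≤ V x ∨ V x ≤ W)} with hQ'
      have h1 := hG (V x) x (R x) (hR0 x hx)
        ((ball_subset_ball (by nlinarith [hR0 x hx])).trans (hballT x hx)) (hbig x hx _ (hVQ x hx))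
      have h2 := ih Q' x (R x) (hR0 x hx) (hballT x hx) (fun W hW => hbig x hx W hW.1) (by
        intro F hF hFc
        have hnot : V x ∉ F := fun hc => (hF _ hc).2.1 rfl
        have := hch (insert (V x) F) (by
          intro W hW
          rcases Finset.mem_insert.1 hW with rfl | hW
          · exact hVQ x hx
          · exact (hF W hW).1) (by
          rw [Finset.coe_insert]
          refine hFc.insert fun W hW _ => ?_
          exact (hF W hW).2.2.symm)
        rw [Finset.card_insert_of_notMem hnot] at this
        omega)
      have hsub : E ∩ closedBall x (R x / 2) ⊆ {y ∈ ball x (R x) | ψ (V x) y < b (V x)} ∪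
          {y ∈ ball x (R x) | y ∉ N ∧ ¬ qndProt ψ a b Q' y} := by
        rintro y ⟨hyE, hyb⟩
        have hyb' : y ∈ ball x (R x) := closedBall_subset_ball (by linarith [hR0 x hx]) hyb
        by_contra hc
        simp only [Set.mem_union, Set.mem_ofPred_eq, not_or, not_and, not_lt, not_not] at hc
        obtain ⟨F, hFQ, hFc, hFa, hFb⟩ := hc.2 hyb' hyE.2.1
        refine hyE.2.2 ⟨insert (V x) F, ?_, ?_, ?_, ?_⟩
        · intro W hW
          rcases Finset.mem_insert.1 hW with rfl | hW
          · exact hVQ x hx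
          · exact (hFQ W hW).1
        · rw [Finset.coe_insert]
          refine hFc.insert fun W hW _ => ?_
          exact (hFQ W hW).2.2.symm
        · intro W hW
          rcases Finset.mem_insert.1 hW with rfl | hW
          · exact hsm x hx y hyb
          · exact hFa W hW
        · intro W hW hWF
          by_cases hWV : W = V x
          · rw [hWV]; exact hc.1 hyb'
          · exact hFb W ⟨hW, hWV, hWF _ (Finset.mem_insert_self _ _)⟩
              fun W' hW' => hWF W' (Finset.mem_insert_of_mem hW')
      calc volume (E ∩ closedBall x (R x / 2)) ≤ _ := measure_mono hsub
        _ ≤ _ := measure_union_le _ _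
        _ ≤ _ := add_le_add h1 h2
        _ = _ := by push_cast; ring
    have hsmall : ∀ x ∈ E, volume (ball x (R x)) ≤ (10 ^ d : ℕ) * volume (closedBall x (R x / 10)) := by
      intro x hx
      have := qnd_vol_scale x x (s := R x / 10) (by linarith [hR0 x hx]) 10 (by norm_num)
      rw [show ((10 : ℕ) : ℝ) * (R x / 10) = R x by push_cast; ring] at this
      rw [this]
      gcongr
      exact ball_subset_closedBall
    set A : ENNReal := ((1 + qndConst (30 ^ d) n : ℕ) : ENNReal) * K with hA
    calc volume E ≤ volume (⋃ x ∈ u, (E ∩ closedBall x (R x / 2))) := measure_mono hcover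
      _ ≤ ∑' x : u, volume (E ∩ closedBall (x : Fin d → ℝ) (R x / 2)) :=
          measure_biUnion_le _ hucount _
      _ ≤ ∑' x : u, A * (10 ^ d : ℕ) * volume (closedBall (x : Fin d → ℝ) (R x / 10)) := by
          refine ENNReal.tsum_le_tsum fun x => ?_
          refine (hpiece x (huE x.2)).trans ?_
          rw [mul_assoc A]
          gcongr
          exact hsmall x (huE x.2)
      _ = A * (10 ^ d : ℕ) * volume (⋃ x ∈ u, closedBall (x : Fin d → ℝ) (R x / 10)) := by
          rw [ENNReal.tsum_mul_left, measure_biUnion hucount hudisj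
            (fun x _ => isClosed_closedBall.measurableSet)]
      _ ≤ A * (10 ^ d : ℕ) * volume (ball z ((3 : ℕ) * s)) := by
          gcongr
          refine Set.iUnion₂_subset fun x hx => ?_
          intro y hy
          have h1 : dist x z < s := (huE hx).1
          have h2 : dist y x ≤ R x / 10 := hy
          have h3 := hR2 x (huE hx)
          have h4 := dist_triangle y x z
          rw [mem_ball]; push_cast; linarith
      _ = _ := by
          rw [qnd_vol_scale z z hs 3 (by norm_num), hA]
          simp only [qndConst]
          push_cast
          rw [show (30 : ENNReal) = 10 * 3 by norm_num, mul_pow]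
          ring
/-- the matrix of rows `g v_a` -/
noncomputable def qndRows {k : ℕ} {ι : Type*} (g : Matrix (Fin k) (Fin k) ℝ)
    (v : ι → Fin k → ℤ) : Matrix ι (Fin k) ℝ :=
  Matrix.of fun a => g.mulVec fun t => ((v a t : ℤ) : ℝ)

lemma covolImg_eq {k r : ℕ} (g : Matrix (Fin k) (Fin k) ℝ) (v : Fin r → Fin k → ℤ) :
    covolImg g v = Real.sqrt (Matrix.det (qndRows g v * (qndRows g v)ᵀ)) := by
  unfold covolImg
  congr 1

lemma qndRows_comb {k r : ℕ} (g : Matrix (Fin k) (Fin k) ℝ) (v w : Fin r → Fin k → ℤ)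
    (A : Matrix (Fin r) (Fin r) ℤ) (h : ∀ a, v a = ∑ b, A a b • w b) :
    qndRows g v = A.map (Int.cast : ℤ → ℝ) * qndRows g w := by
  ext a i
  simp only [qndRows, Matrix.mul_apply, Matrix.of_apply, Matrix.map_apply, Matrix.mulVec,
    dotProduct, h a, Finset.sum_apply, Pi.smul_apply, smul_eq_mul, Int.cast_sum, Int.cast_mul,
    Finset.mul_sum]
  rw [Finset.sum_comm]
  refine Finset.sum_congr rfl fun b _ => Finset.sum_congr rfl fun t _ => ?_
  ring

lemma covolImg_le_of_comb {k r : ℕ} (g : Matrix (Fin k) (Fin k) ℝ) (v w : Fin r → Fin k → ℤ)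
    (hv : LinearIndependent ℤ v) (h : ∀ a, v a ∈ Submodule.span ℤ (Set.range w)) :
    covolImg g w ≤ covolImg g v := by
  have h1 : ∀ a, ∃ c : Fin r → ℤ, ∑ b, c b • w b = v a := fun a =>
    (Submodule.mem_span_range_iff_exists_fun ℤ).1 (h a)
  choose c hc using h1
  have hdet : (Matrix.of c).det ≠ 0 := by
    intro h0
    obtain ⟨x, hx0, hx⟩ := Matrix.exists_vecMul_eq_zero_iff.2 h0
    apply hx0
    have := Fintype.linearIndependent_iff.1 hv x (by
      have : ∀ b, ∑ a, x a * c a b = 0 := fun b => congrFun hx b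
      simp only [← hc, Finset.smul_sum, smul_smul]
      rw [Finset.sum_comm]
      simp only [← Finset.sum_smul, this, zero_smul, Finset.sum_const_zero])
    exact funext this
  rw [covolImg_eq, covolImg_eq, qndRows_comb g v w (Matrix.of c) (fun a => (hc a).symm)]
  apply Real.sqrt_le_sqrt
  set M := qndRows g w
  have hM : 0 ≤ (M * Mᵀ).det := by
    have := (Matrix.posSemidef_self_mul_conjTranspose M).det_nonneg
    simpa [Matrix.conjTranspose_eq_transpose_of_trivial] using this
  have hd : ((Matrix.of c).map (Int.cast : ℤ → ℝ)).det = (((Matrix.of c).det : ℤ) : ℝ) := by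
    exact (Int.cast_det (Matrix.of c)).symm
  rw [Matrix.transpose_mul, show ∀ X : Matrix (Fin r) (Fin r) ℝ, X * M * (Mᵀ * Xᵀ) =
    X * (M * Mᵀ) * Xᵀ by intro X; simp only [Matrix.mul_assoc], Matrix.det_mul, Matrix.det_mul,
    Matrix.det_transpose, hd]
  have h2 : (1 : ℝ) ≤ ((Matrix.of c).det : ℝ) ^ 2 := by
    have : (1 : ℤ) ≤ (Matrix.of c).det ^ 2 := by
      have := pow_pos (abs_pos.2 hdet) 2
      rw [sq_abs] at this
      omega
    exact_mod_cast this
  nlinarith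

lemma qndRows_inj {k r : ℕ} (g : Matrix (Fin k) (Fin k) ℝ) (hg : g.det = 1)
    (v : Fin r → Fin k → ℤ) (hv : LinearIndependent ℤ v) :
    Function.Injective (qndRows g v).vecMul := by
  have h1 : LinearIndependent ℝ (fun i => algebraMap ℤ ℝ ∘ v i) :=
    linearIndependent_algebraMap_comp_iff.2 hv
  have hgi : Function.Injective g.mulVec := by
    rw [Matrix.mulVec_injective_iff_isUnit, Matrix.isUnit_iff_isUnit_det, hg]
    exact isUnit_one
  have h2 : LinearIndependent ℝ (fun i => g.mulVecLin (algebraMap ℤ ℝ ∘ v i)) :=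
    h1.map' g.mulVecLin (LinearMap.ker_eq_bot.2 hgi)
  rw [Matrix.vecMul_injective_iff]
  exact h2

lemma qnd_hadamard {k r : ℕ} (A : Matrix (Fin r) (Fin k) ℝ) (c : Matrix (Fin 1) (Fin k) ℝ)
    (hA : Function.Injective A.vecMul) :
    (Matrix.fromRows A c * (Matrix.fromRows A c)ᵀ).det ≤ (A * Aᵀ).det * ∑ i, c 0 i ^ 2 := by
  have hpd : (A * Aᵀ).PosDef := by
    have := Matrix.PosDef.mul_conjTranspose_self A hA
    simpa [Matrix.conjTranspose_eq_transpose_of_trivial] using this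
  have hinv : Invertible (A * Aᵀ) := hpd.isUnit.invertible
  rw [Matrix.transpose_fromRows, Matrix.fromRows_mul_fromCols, Matrix.det_fromBlocks₁₁]
  refine mul_le_mul_of_nonneg_left ?_ hpd.det_pos.le
  rw [Matrix.det_fin_one, Matrix.sub_apply]
  have h1 : (c * cᵀ) 0 0 = ∑ i, c 0 i ^ 2 := by
    simp [Matrix.mul_apply, sq]
  have h2 : 0 ≤ (c * Aᵀ * ⅟(A * Aᵀ) * (A * cᵀ)) 0 0 := by
    have h3 : (⅟(A * Aᵀ)).PosSemidef := by
      rw [Matrix.invOf_eq_nonsing_inv]; exact hpd.inv.posSemidef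
    have h4 := (h3.mul_mul_conjTranspose_same (c * Aᵀ)).diag_nonneg (i := 0)
    simpa [Matrix.conjTranspose_eq_transpose_of_trivial, Matrix.transpose_mul] using h4
  linarith

lemma covolImg_snoc_le {k r : ℕ} (g : Matrix (Fin k) (Fin k) ℝ) (hg : g.det = 1)
    (v : Fin r → Fin k → ℤ) (hv : LinearIndependent ℤ v) (u : Fin k → ℤ) :
    covolImg g (Fin.snoc (α := fun _ => Fin k → ℤ) v u : Fin (r + 1) → Fin k → ℤ) ≤
      covolImg g v * Real.sqrt (∑ i, (g.mulVec fun t => ((u t : ℤ) : ℝ)) i ^ 2) := by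
  rw [covolImg_eq, covolImg_eq, ← Real.sqrt_mul' _ (by positivity)]
  apply Real.sqrt_le_sqrt
  have h := qnd_hadamard (qndRows g v) (qndRows g (fun _ : Fin 1 => u)) (qndRows_inj g hg v hv)
  refine le_trans (le_of_eq ?_) h
  rw [← Matrix.det_submatrix_equiv_self (finSumFinEquiv : Fin r ⊕ Fin 1 ≃ Fin (r + 1))]
  congr 1
  have : (qndRows g (Fin.snoc (α := fun _ => Fin k → ℤ) v u : Fin (r + 1) → Fin k → ℤ)).submatrix
      (finSumFinEquiv : Fin r ⊕ Fin 1 ≃ Fin (r + 1)) id =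
      Matrix.fromRows (qndRows g v) (qndRows g (fun _ : Fin 1 => u)) := by
    ext a i
    rcases a with a | a
    · have : (Fin.castAdd 1 a) = Fin.castSucc a := rfl
      simp [qndRows, this]
    · have : (Fin.natAdd r a) = Fin.last r := by ext; simp
      simp [qndRows, this]
  rw [← this]
  rfl

/-- cast to rational vectors -/
def qndCast {k : ℕ} (u : Fin k → ℤ) : Fin k → ℚ := fun t => (u t : ℚ)

lemma qnd_basis {k : ℕ} (V : Submodule ℚ (Fin k → ℚ)) :
    ∃ v : Fin (Module.finrank ℚ V) → Fin k → ℤ, LinearIndependent ℤ v ∧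
      (∀ i, qndCast (v i) ∈ V) ∧
      ∀ u : Fin k → ℤ, qndCast u ∈ V → u ∈ Submodule.span ℤ (Set.range v) := by
  let f : (Fin k → ℤ) →ₗ[ℤ] (Fin k → ℚ) :=
    { toFun := qndCast
      map_add' := fun x y => by ext; simp [qndCast]
      map_smul' := fun x y => by ext; simp [qndCast] }
  let S : Submodule ℤ (Fin k → ℤ) := (V.restrictScalars ℤ).comap f
  let b := Module.finBasis ℤ S
  set r := Module.finrank ℤ S with hr
  let v : Fin r → Fin k → ℤ := fun i => (b i : Fin k → ℤ)
  have hvli : LinearIndependent ℤ v :=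
    b.linearIndependent.map' S.subtype (by simp)
  have hvV : ∀ i, qndCast (v i) ∈ V := fun i => (b i).2
  have hspan : ∀ u : Fin k → ℤ, qndCast u ∈ V → u ∈ Submodule.span ℤ (Set.range v) := by
    intro u hu
    have h1 : (⟨u, hu⟩ : S) ∈ Submodule.span ℤ (Set.range b) := by rw [b.span_eq]; trivial
    have h2 := Submodule.mem_map_of_mem (f := S.subtype) h1
    rw [Submodule.map_span, ← Set.range_comp] at h2
    exact h2
  have hli : LinearIndependent ℚ (fun i => qndCast (v i)) := by
    have := (linearIndependent_algebraMap_comp_iff (R := ℤ) (S := ℚ)).2 hvli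
    exact this
  have hspanQ : Submodule.span ℚ (Set.range fun i => qndCast (v i)) = V := by
    apply le_antisymm
    · rw [Submodule.span_le]
      rintro _ ⟨i, rfl⟩
      exact hvV i
    · intro x hx
      obtain ⟨N, hN⟩ := IsLocalization.exist_integer_multiples_of_finite (nonZeroDivisors ℤ) x
      choose y hy using hN
      have hN0 : ((N : ℤ) : ℚ) ≠ 0 := by
        have := nonZeroDivisors.ne_zero N.2
        exact_mod_cast this
      have hyx : qndCast y = ((N : ℤ) : ℚ) • x := by
        ext t
        have := hy t
        simpa [qndCast] using this
      have hyS := hspan y (by rw [hyx]; exact V.smul_mem _ hx)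
      have h3 : qndCast y ∈ Submodule.span ℚ (Set.range fun i => qndCast (v i)) := by
        obtain ⟨c, hc⟩ := (Submodule.mem_span_range_iff_exists_fun ℤ).1 hyS
        have : qndCast y = ∑ i, (c i : ℚ) • qndCast (v i) := by
          ext t
          simp [qndCast, ← hc]
        rw [this]
        exact Submodule.sum_mem _ fun i _ => Submodule.smul_mem _ _ (Submodule.subset_span ⟨i, rfl⟩)
      rw [hyx] at h3
      exact (Submodule.smul_mem_iff _ hN0).1 h3
  have hfr : Module.finrank ℚ V = r := by
    have := finrank_span_eq_card hli
    rw [hspanQ] at this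
    simpa using this
  rw [hfr]
  exact ⟨v, hvli, hvV, hspan⟩

/-- chosen basis -/
noncomputable def qndBasis {k : ℕ} (V : Submodule ℚ (Fin k → ℚ)) :
    Fin (Module.finrank ℚ V) → Fin k → ℤ := (qnd_basis V).choose

lemma qnd_step {k : ℕ} (V : Submodule ℚ (Fin k → ℚ)) (u : Fin k → ℤ) (hu : qndCast u ∉ V)
    (g : Matrix (Fin k) (Fin k) ℝ) (hg : g.det = 1) :
    Module.finrank ℚ (V ⊔ Submodule.span ℚ {qndCast u} : Submodule ℚ (Fin k → ℚ)) =
      Module.finrank ℚ V + 1 ∧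
    covolImg g (qndBasis (V ⊔ Submodule.span ℚ {qndCast u})) ≤
      covolImg g (qndBasis V) * Real.sqrt (∑ i, (g.mulVec fun t => ((u t : ℤ) : ℝ)) i ^ 2) := by
  have hfr : Module.finrank ℚ (V ⊔ Submodule.span ℚ {qndCast u} : Submodule ℚ (Fin k → ℚ)) =
      Module.finrank ℚ V + 1 := Submodule.finrank_sup_span_singleton hu
  refine ⟨hfr, ?_⟩
  obtain ⟨hv1, hv2, hv3⟩ := (qnd_basis V).choose_spec
  obtain ⟨hw1, hw2, hw3⟩ := (qnd_basis (V ⊔ Submodule.span ℚ {qndCast u})).choose_spec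
  refine le_trans ?_ (covolImg_snoc_le g hg _ hv1 u)
  change covolImg g (qndBasis (V ⊔ Submodule.span ℚ {qndCast u})) ≤ covolImg g (Fin.snoc (qndBasis V) u)
  change ∀ u', _ → u' ∈ Submodule.span ℤ (Set.range (qndBasis (V ⊔ Submodule.span ℚ {qndCast u}))) at hw3
  generalize qndBasis (V ⊔ Submodule.span ℚ {qndCast u}) = w at hw3 ⊢
  revert w
  rw [hfr]
  intro w hw3
  refine covolImg_le_of_comb g _ _ ?_ ?_
  · have hQ : LinearIndependent ℚ (Fin.snoc (α := fun _ => Fin k → ℚ)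
        (fun i => qndCast (qndBasis V i)) (qndCast u)) := by
      rw [linearIndependent_finSnoc]
      refine ⟨(linearIndependent_algebraMap_comp_iff (R := ℤ) (S := ℚ)).2 hv1, ?_⟩
      intro hc
      apply hu
      refine (Submodule.span_le.2 ?_) hc
      rintro _ ⟨i, rfl⟩
      exact hv2 i
    rw [← linearIndependent_algebraMap_comp_iff (R := ℤ) (S := ℚ)]
    have e : (fun i => algebraMap ℤ ℚ ∘ (Fin.snoc (α := fun _ => Fin k → ℤ) (qndBasis V) u :
        Fin (Module.finrank ℚ V + 1) → Fin k → ℤ) i) = Fin.snoc (α := fun _ => Fin k → ℚ)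
        (fun i => qndCast (qndBasis V i)) (qndCast u) := by
      funext i
      refine Fin.lastCases ?_ (fun j => ?_) i
      · simp only [Fin.snoc_last]; rfl
      · simp only [Fin.snoc_castSucc]; rfl
    exact e ▸ hQ
  · intro a
    apply hw3
    refine Fin.lastCases ?_ (fun j => ?_) a
    · simp only [Fin.snoc_last]
      exact Submodule.mem_sup_right (Submodule.mem_span_singleton_self _)
    · simp only [Fin.snoc_castSucc]
      exact Submodule.mem_sup_left (hv2 j)

lemma qnd_good {d : ℕ} {C α : ℝ} {T : Set (Fin d → ℝ)} {ψ : (Fin d → ℝ) → ℝ} (hC : 0 < C)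
    (hα : 0 < α) (hψ : ∀ x, 0 ≤ ψ x) (hg : IsGood C α T ψ) {a t : ℝ} (ha : 0 < a) (ht : 0 < t)
    (z : Fin d → ℝ) (s : ℝ) (hs : 0 < s) (hT : ball z s ⊆ T) (hb : qndBig ψ a z s) :
    volume {x ∈ ball z s | ψ x < t * a} ≤ ENNReal.ofReal (C * t ^ α) * volume (ball z s) := by
  have h := hg z s hs hT (t * a) (by positivity)
  have habs' : ∀ x, |ψ x| = ψ x := fun x => abs_of_nonneg (hψ x)
  simp only [habs'] at h
  change _ ≤ ENNReal.ofReal (C * (t * a / sSup (ψ '' ball z s)) ^ α) * volume (ball z s) at h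
  refine h.trans ?_
  have h0 : 0 ≤ t * a / sSup (ψ '' ball z s) := by
    refine div_nonneg (by positivity) (Real.sSup_nonneg ?_)
    rintro _ ⟨x, _, rfl⟩
    exact hψ x
  gcongr
  by_cases hbd : BddAbove (ψ '' ball z s)
  · have hle : a ≤ sSup (ψ '' ball z s) := by
      refine le_of_forall_lt fun η hη => ?_
      obtain ⟨x, hx, hx'⟩ := hb η hη
      exact hx'.trans_le (le_csSup hbd ⟨x, hx, rfl⟩)
    rw [div_le_iff₀ (ha.trans_le hle)]
    gcongr
  · rw [Real.sSup_of_not_bddAbove hbd, div_zero]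
    exact ht.le

lemma qnd_null {d : ℕ} {T : Set (Fin d → ℝ)} (hTo : IsOpen T) {ψ : (Fin d → ℝ) → ℝ} {a b : ℝ}
    {K : ENNReal} (hK : K < 1)
    (hG : ∀ z s, 0 < s → ball z s ⊆ T → qndBig ψ a z s →
      volume {x ∈ ball z s | ψ x < b} ≤ K * volume (ball z s)) :
    volume {x | x ∈ T ∧ ψ x < b ∧ ∀ s > 0, qndBig ψ a x s} = 0 := by
  set S := {x | x ∈ T ∧ ψ x < b ∧ ∀ s > 0, qndBig ψ a x s} with hS
  have hae := Besicovitch.ae_tendsto_measure_inter_div (volume : Measure (Fin d → ℝ)) S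
  rw [ae_iff] at hae
  refine le_antisymm ?_ zero_le
  rw [← hae]
  refine le_trans ?_ (Measure.le_restrict_apply _ _)
  apply measure_mono
  intro x hx
  refine ⟨?_, hx⟩
  intro htend
  obtain ⟨e, he, heT⟩ := Metric.isOpen_iff.1 hTo x hx.1
  have h1 := htend.eventually (lt_mem_nhds hK)
  have h2 : ∀ᶠ r in nhdsWithin (0 : ℝ) (Set.Ioi 0), r ∈ Set.Ioo 0 e := Ioo_mem_nhdsGT he
  obtain ⟨r, hr1, hr2⟩ := (h1.and h2).exists
  have hr0 : 0 < r := hr2.1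
  have hb := hG x r hr0 ((ball_subset_ball hr2.2.le).trans heT) (hx.2.2 r hr0)
  have hle : volume (S ∩ closedBall x r) ≤ K * volume (closedBall x r) := by
    calc volume (S ∩ closedBall x r) ≤ volume ({y ∈ ball x r | ψ y < b} ∪ sphere x r) := by
          apply measure_mono
          rintro y ⟨hyS, hyb⟩
          rw [← ball_union_sphere] at hyb
          rcases hyb with h | h
          · exact Or.inl ⟨h, hyS.2.1⟩
          · exact Or.inr h
      _ ≤ volume {y ∈ ball x r | ψ y < b} + volume (sphere x r) := measure_union_le _ _
      _ = volume {y ∈ ball x r | ψ y < b} := by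
          rw [Measure.addHaar_sphere_of_ne_zero _ _ hr0.ne', add_zero]
      _ ≤ K * volume (ball x r) := hb
      _ ≤ _ := by gcongr; exact ball_subset_closedBall
  exact absurd hr1 (not_lt.2 (ENNReal.div_le_of_le_mul hle))

lemma qnd_prot_short {d k : ℕ} {ρ ε : ℝ} (hρ : 0 < ρ)
    (h : (Fin d → ℝ) → Matrix (Fin k) (Fin k) ℝ) (x : Fin d → ℝ) (hx : (h x).det = 1)
    (hp : qndProt (P := Submodule ℚ (Fin k → ℚ)) (fun V x => covolImg (h x) (qndBasis V))
      (fun V => ρ ^ Module.finrank ℚ V) (fun V => ε / ρ * ρ ^ Module.finrank ℚ V) {V | V ≠ ⊥} x)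
    (u : Fin k → ℤ) (hu : u ≠ 0) :
    ε ≤ Real.sqrt (∑ i, ((h x).mulVec fun t => ((u t : ℤ) : ℝ)) i ^ 2) := by
  classical
  obtain ⟨F, hFQ, hFc, hFa, hFb⟩ := hp
  have hu0 : qndCast u ≠ 0 := by
    intro hc
    apply hu
    ext t
    have := congrFun hc t
    simpa [qndCast] using this
  have hV : ∃ V : Submodule ℚ (Fin k → ℚ), qndCast u ∉ V ∧
      covolImg (h x) (qndBasis V) ≤ ρ ^ Module.finrank ℚ V ∧
      ∀ W ∈ F, if qndCast u ∈ W then V ≤ W else W ≤ V := by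
    by_cases hne : (F.filter fun W => qndCast u ∉ W).Nonempty
    · obtain ⟨V, hVm⟩ := Finset.exists_maximal hne
      have hVF := Finset.mem_filter.1 hVm.1
      refine ⟨V, hVF.2, hFa V hVF.1, fun W hW => ?_⟩
      have htot := hFc.total hVF.1 hW
      split_ifs with hWu
      · rcases htot with h1 | h1
        · exact h1
        · exact absurd (h1 hWu) hVF.2
      · rcases htot with h1 | h1
        · exact hVm.2 (Finset.mem_filter.2 ⟨hW, hWu⟩) h1
        · exact h1
    · refine ⟨⊥, by simpa using hu0, ?_, fun W hW => ?_⟩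
      · have key : ∀ (r : ℕ) (v : Fin r → Fin k → ℤ), r = 0 → covolImg (h x) v ≤ ρ ^ r := by
          rintro r v rfl
          simp [covolImg]
        exact key _ _ (by simp)
      · split_ifs with hWu
        · exact bot_le
        · exact absurd ⟨W, Finset.mem_filter.2 ⟨hW, hWu⟩⟩ hne
  obtain ⟨V, hVu, hVa, hVF⟩ := hV
  obtain ⟨hfr, hle⟩ := qnd_step V u hVu (h x) hx
  have hb := hFb (V ⊔ Submodule.span ℚ {qndCast u}) (by
    intro hc
    apply hu0
    have : qndCast u ∈ V ⊔ Submodule.span ℚ {qndCast u} :=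
      Submodule.mem_sup_right (Submodule.mem_span_singleton_self _)
    rw [hc] at this
    simpa using this) (by
    intro W hW
    have := hVF W hW
    split_ifs at this with hWu
    · left
      refine sup_le this ?_
      rw [Submodule.span_singleton_le_iff_mem]
      exact hWu
    · right
      exact this.trans le_sup_left)
  simp only [hfr] at hb
  set L := Real.sqrt (∑ i, ((h x).mulVec fun t => ((u t : ℤ) : ℝ)) i ^ 2) with hL
  have hL0 : 0 ≤ L := Real.sqrt_nonneg _
  have hpos : 0 < ρ ^ Module.finrank ℚ V := by positivity
  have h1 : ε / ρ * ρ ^ (Module.finrank ℚ V + 1) = ρ ^ Module.finrank ℚ V * ε := by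
    rw [pow_succ]; field_simp
  have h2 : ρ ^ Module.finrank ℚ V * ε ≤ ρ ^ Module.finrank ℚ V * L := by
    rw [← h1]
    exact hb.trans (hle.trans (mul_le_mul_of_nonneg_right hVa hL0))
  exact le_of_mul_le_mul_left h2 hpos

lemma qnd_chain {k : ℕ} (F : Finset (Submodule ℚ (Fin k → ℚ))) (hF : ∀ V ∈ F, V ≠ ⊥)
    (hc : IsChain (· ≤ ·) (F : Set (Submodule ℚ (Fin k → ℚ)))) : F.card ≤ k := by
  have : F.card ≤ (Finset.Icc 1 k).card := by
    refine Finset.card_le_card_of_injOn (fun V => Module.finrank ℚ V) ?_ ?_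
    · intro V hV
      have h1 : 0 < Module.finrank ℚ V := by
        rw [Module.finrank_pos_iff]
        exact Submodule.nontrivial_iff_ne_bot.2 (hF V hV)
      have h2 := Submodule.finrank_le V
      simp only [Module.finrank_fin_fun] at h2
      simp only [Finset.coe_Icc, Set.mem_Icc]
      omega
    · intro V hV W hW hVW
      rcases hc.total hV hW with h | h
      · exact Submodule.eq_of_le_of_finrank_eq h hVW
      · exact (Submodule.eq_of_le_of_finrank_eq h hVW.symm).symm
  simpa using this

/-- Theorem 0.2 (quantitative nondivergence with rank-dependent lower bounds).
Let `B = B(x₀, r₀) ⊆ ℝ^d`, `B̃ = B(x₀, 3^k r₀)`, and `h : B̃ → SL_k(ℝ)` be such that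
(i) for every subgroup `Γ ⊆ ℤ^k` (encoded by a `ℤ`-basis `v`), `x ↦ ‖h(x)Γ‖` is
`(C,α)`-good on `B̃`, and (ii) `sup_{x ∈ B} ‖h(x)Γ‖ ≥ ρ^{rk Γ}`.  Then for every
`0 < ε ≤ ρ`, `λ {x ∈ B : h(x)ℤ^k ∉ K_ε} ≤ const(d,k)·C·(ε/ρ)^α·λ(B)`. -/
theorem quantitative_nondivergence (d k : ℕ) :
    ∃ Cst : ℝ, 0 < Cst ∧
      ∀ (C α ρ r₀ : ℝ) (x₀ : Fin d → ℝ) (h : (Fin d → ℝ) → Matrix (Fin k) (Fin k) ℝ),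
        0 < C → 0 < α → 0 < ρ → 0 < r₀ →
        (∀ x ∈ ball x₀ (3 ^ k * r₀), (h x).det = 1) →
        (∀ (r : ℕ) (v : Fin r → Fin k → ℤ), LinearIndependent ℤ v →
          IsGood C α (ball x₀ (3 ^ k * r₀)) (fun x => covolImg (h x) v)) →
        (∀ (r : ℕ) (v : Fin r → Fin k → ℤ), LinearIndependent ℤ v →
          ρ ^ r ≤ sSup ((fun x => covolImg (h x) v) '' ball x₀ r₀)) →
        ∀ ε : ℝ, 0 < ε → ε ≤ ρ →
          volume {x ∈ ball x₀ r₀ | ∃ u : Fin k → ℤ, u ≠ 0 ∧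
              Real.sqrt (∑ i, ((h x).mulVec fun t => ((u t : ℤ) : ℝ)) i ^ 2) < ε} ≤
            ENNReal.ofReal (Cst * C * (ε / ρ) ^ α) * volume (ball x₀ r₀) := by

  classical
  set c : ℕ := qndConst (30 ^ d) k with hc
  refine ⟨(c : ℝ) + 1, by positivity, ?_⟩
  intro C α ρ r₀ x₀ h hC hα hρ hr₀ hdet hgood hsup ε hε hερ
  set t : ℝ := ε / ρ with ht
  have ht0 : 0 < t := by positivity
  have hCt : 0 < C * t ^ α := by positivity
  set T : Set (Fin d → ℝ) := ball x₀ (3 ^ k * r₀) with hT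
  have hBT : ball x₀ r₀ ⊆ T := ball_subset_ball (by
    have : (1 : ℝ) ≤ 3 ^ k := one_le_pow₀ (by norm_num)
    nlinarith)
  by_cases hbig : 1 ≤ C * t ^ α
  · calc _ ≤ volume (ball x₀ r₀) := measure_mono fun x hx => hx.1
      _ = 1 * volume (ball x₀ r₀) := (one_mul _).symm
      _ ≤ _ := by
        gcongr
        rw [ENNReal.one_le_ofReal, mul_assoc]
        have : (0 : ℝ) ≤ c := by positivity
        nlinarith
  push Not at hbig
  set K : ENNReal := ENNReal.ofReal (C * t ^ α) with hK
  have hK1 : K < 1 := by rw [hK, ENNReal.ofReal_lt_one]; exact hbig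
  have hG : ∀ (r : ℕ) (v : Fin r → Fin k → ℤ), LinearIndependent ℤ v → ∀ z s, 0 < s →
      ball z s ⊆ T → qndBig (fun x => covolImg (h x) v) (ρ ^ r) z s →
      volume {x ∈ ball z s | covolImg (h x) v < t * ρ ^ r} ≤ K * volume (ball z s) := by
    intro r v hv z s hs hzT hb
    exact qnd_good hC hα (fun x => Real.sqrt_nonneg _) (hgood r v hv) (by positivity) ht0
      z s hs hzT hb
  let N : Set (Fin d → ℝ) := ⋃ p : {p : (Σ r : ℕ, (Fin r → Fin k → ℤ)) // LinearIndependent ℤ p.2},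
    {x | x ∈ T ∧ covolImg (h x) p.1.2 < t * ρ ^ p.1.1 ∧
      ∀ s > 0, qndBig (fun x => covolImg (h x) p.1.2) (ρ ^ p.1.1) x s}
  have hN0 : volume N = 0 := by
    rw [measure_iUnion_null_iff]
    rintro ⟨⟨r, v⟩, hv⟩
    exact qnd_null isOpen_ball hK1 (hG r v hv)
  have hli : ∀ V : Submodule ℚ (Fin k → ℚ), LinearIndependent ℤ (qndBasis V) :=
    fun V => (qnd_basis V).choose_spec.1
  have hmain := qnd_induct (P := Submodule ℚ (Fin k → ℚ))
    (fun V x => covolImg (h x) (qndBasis V))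
    (fun V => ρ ^ Module.finrank ℚ V) (fun V => t * ρ ^ Module.finrank ℚ V) T N K
    (fun V => hG _ _ (hli V))
    (by
      intro x hxT hxN V hlt
      by_contra! hcon
      apply hxN
      refine Set.mem_iUnion.2 ⟨⟨⟨_, qndBasis V⟩, hli V⟩, hxT, hlt, hcon⟩)
    k {V | V ≠ ⊥} x₀ r₀ hr₀ le_rfl
    (by
      intro V _ η hη
      obtain ⟨_, ⟨x, hx, rfl⟩, hlt⟩ := exists_lt_of_lt_csSup
        ((nonempty_ball.2 hr₀).image _) (hη.trans_le (hsup _ _ (hli V)))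
      exact ⟨x, hx, hlt⟩)
    (fun F hF hFc => qnd_chain F hF hFc)
  calc _ ≤ volume (N ∪ {x ∈ ball x₀ r₀ | x ∉ N ∧ ¬ qndProt (P := Submodule ℚ (Fin k → ℚ))
        (fun V x => covolImg (h x) (qndBasis V)) (fun V => ρ ^ Module.finrank ℚ V)
        (fun V => t * ρ ^ Module.finrank ℚ V) {V | V ≠ ⊥} x}) := by
        apply measure_mono
        rintro x ⟨hx, u, hu, hlt⟩
        by_cases hxN : x ∈ N
        · exact Or.inl hxN
        · refine Or.inr ⟨hx, hxN, fun hp => ?_⟩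
          exact absurd (qnd_prot_short hρ h x (hdet x (hBT hx)) hp u hu) (not_le.2 hlt)
    _ ≤ volume N + _ := measure_union_le _ _
    _ ≤ 0 + (c : ENNReal) * K * volume (ball x₀ r₀) := add_le_add hN0.le hmain
    _ = (c : ENNReal) * K * volume (ball x₀ r₀) := zero_add _
    _ ≤ _ := by
        gcongr
        rw [hK, ← ENNReal.ofReal_natCast, ← ENNReal.ofReal_mul (by positivity), mul_assoc]
        apply ENNReal.ofReal_le_ofReal
        nlinarith
end
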